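/- Let s < 0 be an integer and d ≥ 0 such that S_d(s) ≠ 0 (equivalently, U_d(−s) ≠ ∅). Let M = (M_0, …, M_d) be the modest element of U_d(−s), i.e., the unique element whose reverse (M_d, M_{d−1}, …, M_0) is lexicographically largest among reverses of elements of U_d(−s). Then wt(M) < wt(m) for every m ∈ U_d(−s) with m ≠ M, and consequently the t-adic valuation of the polynomial S_d(s) equals wt(M). -/

import Mathlib

open Polynomial

/-- The power sum `S_d(-k) = ∑_{a monic, deg a = d} a^k`, written as a sum over the
lower-order coefficients of the monic polynomial. -/
noncomputable def powerSum (Fq : Type) [Field Fq] [Fintype Fq] (d k : ℕ) : Polynomial Fq :=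
  ∑ c : Fin d → Fq, (X ^ d + ∑ i : Fin d, C (c i) * X ^ (i : ℕ)) ^ k

/-- `m` sums to `k` with no carrying of digits in base `p`. -/
def NoCarry (p : ℕ) {n : ℕ} (m : Fin n → ℕ) (k : ℕ) : Prop :=
  (∑ i, m i) = k ∧ ∀ j : ℕ, (∑ i, m i / p ^ j % p) = k / p ^ j % p

/-- The set `U_d(k)`. -/
def Uset (p q d k : ℕ) : Set (Fin (d + 1) → ℕ) :=
  {m | NoCarry p m k ∧ ∀ i : Fin (d + 1), 0 < (i : ℕ) → 0 < m i ∧ (q - 1) ∣ m i}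

/-- The weight of an element of `U_d(k)`. -/
def wtU {d : ℕ} (m : Fin (d + 1) → ℕ) : ℕ :=
  ∑ i : Fin (d + 1), (d - (i : ℕ)) * m i

/-- Strict lexicographic order on tuples. -/
def LexLT {n : ℕ} (x y : Fin n → ℕ) : Prop :=
  ∃ i, (∀ j, j < i → x j = y j) ∧ x i < y i

/-- Lexicographic order on tuples. -/
def LexLE {n : ℕ} (x y : Fin n → ℕ) : Prop := x = y ∨ LexLT x y

/-- `L_k := min_{0 ≤ i < f} l(k p^i)/(q-1)` where `l` is the base-`q` digit sum, `q = p^f`. -/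
noncomputable def Lval (p f k : ℕ) (hf : 0 < f) : ℚ :=
  (Finset.range f).inf' ⟨0, Finset.mem_range.mpr hf⟩
    (fun i => ((Nat.digits (p ^ f) (k * p ^ i)).sum : ℚ) / ((p : ℚ) ^ f - 1))

/-- The set `W_d(N)` of compositions. -/
def Wset (p q d N : ℕ) : Set (Fin d → ℕ) :=
  {Y | NoCarry p Y N ∧ ∀ i : Fin d, (i : ℕ) + 1 < d → 0 < Y i ∧ (q - 1) ∣ Y i}

/-- The weight of a composition. -/
def wtW {d : ℕ} (Y : Fin d → ℕ) : ℕ := ∑ i : Fin d, ((i : ℕ) + 1) * Y i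

/-- `X` is the modest (lexicographically largest) composition in `W_d(N)`. -/
def Modest (p q : ℕ) {d : ℕ} (N : ℕ) (X : Fin d → ℕ) : Prop :=
  X ∈ Wset p q d N ∧ ∀ Y ∈ Wset p q d N, LexLE Y X

/-- `X` is an optimal (minimum weight) composition in `W_d(N)`. -/
def Optimal (p q : ℕ) {d : ℕ} (N : ℕ) (X : Fin d → ℕ) : Prop :=
  X ∈ Wset p q d N ∧ ∀ Y ∈ Wset p q d N, wtW X ≤ wtW Y

/-- `Γ(n) : Fin f → ℕ`, summing the base-`p` digits of `n` in each residue class mod `f`. -/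
def Gamma (p f n : ℕ) : Fin f → ℕ :=
  fun i => ∑ j ∈ Finset.range (Nat.log p n + 1), if j % f = (i : ℕ) then n / p ^ j % p else 0

/-- The cyclic matrix `E`, as a map: `(E x)_i = p x_{i+1} - x_i`, indices mod `f`. -/
def Emap (p : ℕ) {R : Type} [Ring R] {f : ℕ} (x : Fin f → R) : Fin f → R :=
  fun i => (p : R) * x ⟨((i : ℕ) + 1) % f, Nat.mod_lt _ i.pos⟩ - x i

/-- `𝔍 = {Γ(n) : n > 0 is q-even}`, where `q = p ^ f`. -/
def Jfrak (p f : ℕ) : Set (Fin f → ℕ) :=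
  {w | ∃ n : ℕ, 0 < n ∧ (p ^ f - 1) ∣ n ∧ Gamma p f n = w}

/-- `I_d`. -/
def Iset (p f d : ℕ) : Set (Fin f → ℕ) :=
  {u | (∃ n : ℕ, 0 < n ∧ Gamma p f n = u) ∧
    ∃ v : Fin (d - 1) → Fin f → ℕ, (∀ j, v j ∈ Jfrak p f) ∧ (∑ j, v j) < u}

/-- `J_d`. -/
def Jset (p f d : ℕ) : Set (Fin f → ℕ) :=
  if d = 0 then ∅ else Jfrak p f ∩ (Iset p f d \ Iset p f (d + 1))

/-- A composition is `τ`-monotonic. -/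
def TauMonotonic (p f : ℕ) {d : ℕ} (X : Fin d → ℕ) : Prop :=
  ∀ i j : Fin d, i < j → ∀ m n : ℕ, X i / p ^ m % p ≠ 0 → X j / p ^ n % p ≠ 0 →
    m % f = n % f → n ≤ m

/-- `W_d^B(N)`: compositions in `W_d(N)` whose `Γ`-matrix is `B`. -/
def WBset (p f d N : ℕ) (B : Fin d → Fin f → ℕ) : Set (Fin d → ℕ) :=
  {Y | Y ∈ Wset p (p ^ f) d N ∧ ∀ j, Gamma p f (Y j) = B j}

/-- The multizeta value `ζ(-k_1, …, -k_r)` as a (finite) sum over strictly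
decreasing tuples of degrees. -/
noncomputable def multizeta (Fq : Type) [Field Fq] [Fintype Fq] {r : ℕ} (k : Fin r → ℕ) :
    Polynomial Fq :=
  ∑ᶠ (dt : Fin r → ℕ) (_ : StrictAnti dt), ∏ i, powerSum Fq (dt i) (k i)



namespace Sheats

/-- digit weight seen from cut `i` -/
def lam (p f i t : ℕ) : ℕ := p ^ ((t + i) % f)
/-- total digit weight -/
def Lam (p f i : ℕ) (B : Multiset ℕ) : ℕ := (B.map (lam p f i)).sum
/-- numerical value of a multiset of exponents -/
def val (p : ℕ) (B : Multiset ℕ) : ℕ := (B.map (fun t => p ^ t)).sum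
/-- number of elements with position `k` seen from cut `i` -/
def cp (f i k : ℕ) (B : Multiset ℕ) : ℕ := B.countP (fun t => (t + i) % f = k)

@[simp] lemma Lam_zero (p f i : ℕ) : Lam p f i 0 = 0 := by simp [Lam]
@[simp] lemma Lam_add (p f i : ℕ) (B C : Multiset ℕ) : Lam p f i (B + C) = Lam p f i B + Lam p f i C := by
  simp [Lam]
@[simp] lemma Lam_cons (p f i t : ℕ) (B : Multiset ℕ) : Lam p f i (t ::ₘ B) = lam p f i t + Lam p f i B := by
  simp [Lam]
@[simp] lemma Lam_singleton (p f i t : ℕ) : Lam p f i {t} = lam p f i t := by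
  simp [Lam]
@[simp] lemma Lam_nsmul (p f i n : ℕ) (B : Multiset ℕ) : Lam p f i (n • B) = n * Lam p f i B := by
  simp [Lam, Multiset.map_nsmul, Multiset.sum_nsmul]
@[simp] lemma val_zero (p : ℕ) : val p 0 = 0 := by simp [val]
@[simp] lemma val_add (p : ℕ) (B C : Multiset ℕ) : val p (B + C) = val p B + val p C := by
  simp [val]
@[simp] lemma val_cons (p t : ℕ) (B : Multiset ℕ) : val p (t ::ₘ B) = p ^ t + val p B := by
  simp [val]
@[simp] lemma val_singleton (p t : ℕ) : val p {t} = p ^ t := by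
  simp [val]
@[simp] lemma val_nsmul (p n : ℕ) (B : Multiset ℕ) : val p (n • B) = n * val p B := by
  simp [val, Multiset.map_nsmul, Multiset.sum_nsmul]
@[simp] lemma cp_zero (f i k : ℕ) : cp f i k 0 = 0 := by simp [cp]
@[simp] lemma cp_add (f i k : ℕ) (B C : Multiset ℕ) : cp f i k (B + C) = cp f i k B + cp f i k C := by
  simp [cp]
lemma cp_cons (f i k t : ℕ) (B : Multiset ℕ) :
    cp f i k (t ::ₘ B) = cp f i k B + if (t + i) % f = k then 1 else 0 := by
  simp only [cp, Multiset.countP_cons]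

lemma Lam_le (p f i : ℕ) {B C : Multiset ℕ} (h : B ≤ C) : Lam p f i B ≤ Lam p f i C := by
  obtain ⟨D, rfl⟩ := Multiset.le_iff_exists_add.1 h
  simp
lemma val_le (p : ℕ) {B C : Multiset ℕ} (h : B ≤ C) : val p B ≤ val p C := by
  obtain ⟨D, rfl⟩ := Multiset.le_iff_exists_add.1 h
  simp

lemma lam_pos {p : ℕ} (hp : 2 ≤ p) (f i t : ℕ) : 0 < lam p f i t := by
  unfold lam; positivity

lemma Lam_pos {p : ℕ} (hp : 2 ≤ p) (f i : ℕ) {B : Multiset ℕ} (h : B ≠ 0) : 0 < Lam p f i B := by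
  obtain ⟨t, ht⟩ := Multiset.exists_mem_of_ne_zero h
  obtain ⟨D, rfl⟩ := Multiset.exists_cons_of_mem ht
  have := lam_pos hp f i t
  simp; omega

lemma val_pos {p : ℕ} (hp : 2 ≤ p) {B : Multiset ℕ} (h : B ≠ 0) : 0 < val p B := by
  obtain ⟨t, ht⟩ := Multiset.exists_mem_of_ne_zero h
  obtain ⟨D, rfl⟩ := Multiset.exists_cons_of_mem ht
  have : 0 < p ^ t := by positivity
  simp; omega

lemma q_eq {p f : ℕ} (hp : 2 ≤ p) (hf : 0 < f) : p * p ^ (f - 1) = p ^ f := by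
  obtain ⟨g, rfl⟩ : ∃ g, f = g + 1 := ⟨f - 1, by omega⟩
  simp [pow_succ, mul_comm]

lemma q1_add {p f : ℕ} (hp : 2 ≤ p) : p ^ f - 1 + 1 = p ^ f := by
  have : 0 < p ^ f := by positivity
  omega

lemma pow_le_q1 {p f : ℕ} (hp : 2 ≤ p) (hf : 0 < f) : p ^ (f - 1) ≤ p ^ f - 1 := by
  have h := q_eq hp hf
  have : 0 < p ^ (f - 1) := by positivity
  nlinarith [q1_add (f := f) hp]

lemma lam_le {p f : ℕ} (hp : 2 ≤ p) (hf : 0 < f) (i t : ℕ) : lam p f i t ≤ p ^ (f - 1) := by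
  unfold lam
  have := Nat.mod_lt (t + i) hf
  exact Nat.pow_le_pow_right (by omega) (by omega)

lemma lam_le_q1 {p f : ℕ} (hp : 2 ≤ p) (hf : 0 < f) (i t : ℕ) : lam p f i t ≤ p ^ f - 1 :=
  (lam_le hp hf i t).trans (pow_le_q1 hp hf)

lemma lam_congr (p f : ℕ) {i j s t : ℕ} (h : (s + i) % f = (t + j) % f) : lam p f i s = lam p f j t := by
  unfold lam; rw [h]

lemma Lam_mod (p f i : ℕ) (B : Multiset ℕ) : Lam p f (i % f) B = Lam p f i B := by
  unfold Lam
  congr 1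
  apply Multiset.map_congr rfl
  intro t _
  apply lam_congr; simp

lemma Lam_congr (p f : ℕ) {i j : ℕ} (h : i % f = j % f) (B : Multiset ℕ) : Lam p f i B = Lam p f j B := by
  rw [← Lam_mod, h, Lam_mod]

lemma lam_succ {p f : ℕ} (hp : 2 ≤ p) (hf : 0 < f) (i t : ℕ) :
    p * lam p f i t = lam p f (i + 1) t + (p ^ f - 1) * (if (t + i) % f = f - 1 then 1 else 0) := by
  unfold lam
  have hm := Nat.mod_lt (t + i) hf
  have e : (t + (i + 1)) % f = ((t + i) % f + 1) % f := by
    rw [Nat.mod_add_mod]; congr 1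
  split_ifs with h
  · have : (t + (i + 1)) % f = 0 := by
      rw [e, h, Nat.sub_add_cancel hf, Nat.mod_self]
    rw [this, h, q_eq hp hf]
    have := q1_add (f := f) hp
    simp only [pow_zero, mul_one]
    omega
  · have : (t + (i + 1)) % f = (t + i) % f + 1 := by
      rw [e]; apply Nat.mod_eq_of_lt; omega
    rw [this, pow_succ]; ring

lemma Lam_succ {p f : ℕ} (hp : 2 ≤ p) (hf : 0 < f) (i : ℕ) (B : Multiset ℕ) :
    p * Lam p f i B = Lam p f (i + 1) B + (p ^ f - 1) * cp f i (f - 1) B := by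
  induction B using Multiset.induction_on with
  | empty => simp
  | cons t B ih =>
    rw [Lam_cons, Lam_cons, cp_cons, mul_add, ih, lam_succ hp hf]
    ring

lemma Lam_succ_le {p f : ℕ} (hp : 2 ≤ p) (hf : 0 < f) (i k : ℕ) (B : Multiset ℕ) :
    Lam p f (i + k) B ≤ p ^ k * Lam p f i B := by
  induction k with
  | zero => simp
  | succ k ih =>
    have := Lam_succ hp hf (i + k) B
    calc Lam p f (i + (k + 1)) B ≤ p * Lam p f (i + k) B := by rw [this]; exact Nat.le_add_right _ _
      _ ≤ p * (p ^ k * Lam p f i B) := Nat.mul_le_mul_left _ ih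
      _ = _ := by ring

lemma pow_f_modEq {p f : ℕ} (hp : 2 ≤ p) : p ^ f ≡ 1 [MOD p ^ f - 1] := by
  have := q1_add (f := f) hp
  have h : p ^ f - 1 + 1 ≡ 1 [MOD p ^ f - 1] := by
    simp [Nat.ModEq]
  rwa [this] at h

lemma pow_mod_modEq {p f : ℕ} (hp : 2 ≤ p) (n : ℕ) : p ^ (n % f) ≡ p ^ n [MOD p ^ f - 1] := by
  conv_rhs => rw [← Nat.mod_add_div n f, pow_add, pow_mul]
  have := ((pow_f_modEq (f := f) hp).pow (n / f)).mul_left (p ^ (n % f))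
  simpa using this.symm

lemma Lam_modEq {p f : ℕ} (hp : 2 ≤ p) (i : ℕ) (B : Multiset ℕ) :
    Lam p f i B ≡ p ^ i * val p B [MOD p ^ f - 1] := by
  induction B using Multiset.induction_on with
  | empty => simp [Nat.ModEq]
  | cons t B ih =>
    rw [Lam_cons, val_cons, mul_add]
    refine Nat.ModEq.add ?_ ih
    unfold lam
    have := pow_mod_modEq (f := f) hp (t + i)
    rw [pow_add, mul_comm] at this
    exact this

lemma coprime_pow {p f : ℕ} (hp : 2 ≤ p) (hf : 0 < f) (i : ℕ) : Nat.Coprime (p ^ f - 1) (p ^ i) := by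
  apply Nat.Coprime.pow_right
  have h1 := q1_add (f := f) hp
  have h2 := q_eq hp hf
  have : Nat.Coprime (p * p ^ (f - 1) - 1) (p * p ^ (f - 1)) := by
    rw [h2]
    rw [Nat.coprime_comm]
    conv_lhs => rw [← h1]
    simp
  exact Nat.Coprime.coprime_mul_right_right this |>.symm.symm |> fun h => by rwa [h2] at h

lemma Lam_modEq_of_val {p f : ℕ} (hp : 2 ≤ p) (i : ℕ) {B C : Multiset ℕ}
    (h : val p B ≡ val p C [MOD p ^ f - 1]) : Lam p f i B ≡ Lam p f i C [MOD p ^ f - 1] :=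
  (Lam_modEq hp i B).trans ((h.mul_left _).trans (Lam_modEq hp i C).symm)

lemma val_modEq_of_Lam {p f : ℕ} (hp : 2 ≤ p) (hf : 0 < f) (i : ℕ) {B C : Multiset ℕ}
    (h : Lam p f i B ≡ Lam p f i C [MOD p ^ f - 1]) : val p B ≡ val p C [MOD p ^ f - 1] := by
  have := (Lam_modEq hp i B).symm.trans (h.trans (Lam_modEq hp i C))
  exact Nat.ModEq.cancel_left_of_coprime (coprime_pow hp hf i) this

lemma dvd_Lam_of_val {p f : ℕ} (hp : 2 ≤ p) (i : ℕ) {B : Multiset ℕ}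
    (h : p ^ f - 1 ∣ val p B) : p ^ f - 1 ∣ Lam p f i B := by
  have := Lam_modEq (f := f) hp i B
  exact (Nat.ModEq.dvd_iff this dvd_rfl).2 (h.mul_left _)

lemma dvd_val_of_Lam {p f : ℕ} (hp : 2 ≤ p) (hf : 0 < f) (i : ℕ) {B : Multiset ℕ}
    (h : p ^ f - 1 ∣ Lam p f i B) : p ^ f - 1 ∣ val p B := by
  have := Lam_modEq (f := f) hp i B
  exact (coprime_pow hp hf i).dvd_of_dvd_mul_left ((Nat.ModEq.dvd_iff this dvd_rfl).1 h)

lemma q1_le_Lam {p f : ℕ} (hp : 2 ≤ p) (i : ℕ) {B : Multiset ℕ} (hB : B ≠ 0)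
    (h : p ^ f - 1 ∣ val p B) : p ^ f - 1 ≤ Lam p f i B :=
  Nat.le_of_dvd (Lam_pos hp f i hB) (dvd_Lam_of_val hp i h)

lemma Lam_digits {f : ℕ} (p : ℕ) (hf : 0 < f) (i : ℕ) (B : Multiset ℕ) :
    Lam p f i B = ∑ k ∈ Finset.range f, cp f i k B * p ^ k := by
  induction B using Multiset.induction_on with
  | empty => simp
  | cons t B ih =>
    rw [Lam_cons, ih]
    simp_rw [cp_cons, add_mul, Finset.sum_add_distrib]
    rw [add_comm]
    congr 1
    simp [lam, Nat.mod_lt _ hf]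

lemma geom (p m : ℕ) (hp : 2 ≤ p) : ∑ k ∈ Finset.range m, (p - 1) * p ^ k + 1 = p ^ m := by
  induction m with
  | zero => simp
  | succ m ih =>
    rw [Finset.sum_range_succ, pow_succ]
    obtain ⟨a, rfl⟩ : ∃ a, p = a + 1 := ⟨p - 1, by omega⟩
    simp only [Nat.add_sub_cancel] at *
    nlinarith

/-- digit multisets: each class occurs at most `p-1` times -/
def Dig (p f : ℕ) (g : Multiset ℕ) : Prop := ∀ i k, k < f → cp f i k g ≤ p - 1

lemma Dig_Lam_lt {p f : ℕ} (hp : 2 ≤ p) (hf : 0 < f) {g : Multiset ℕ} (hg : Dig p f g) (i m : ℕ) (hm : m ≤ f)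
    (h : ∀ t ∈ g, (t + i) % f < m) : Lam p f i g < p ^ m := by
  rw [Lam_digits p hf, ← geom p m hp, Nat.lt_succ_iff]
  rw [← Finset.sum_subset (Finset.range_mono hm)]
  · apply Finset.sum_le_sum
    intro k hk
    apply Nat.mul_le_mul_right
    apply hg
    simp at hk; omega
  · intro k hk hk'
    have : cp f i k g = 0 := by
      unfold cp
      rw [Multiset.countP_eq_zero]
      intro t ht e
      have := h t ht
      simp at hk'
      omega
    simp [this]

lemma Dig_Lam_le {p f : ℕ} (hp : 2 ≤ p) (hf : 0 < f) {g : Multiset ℕ} (hg : Dig p f g) (i : ℕ) :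
    Lam p f i g ≤ p ^ f - 1 := by
  have := Dig_Lam_lt hp hf hg i f le_rfl (fun t _ => Nat.mod_lt _ hf)
  omega

/-- congruent and positive implies at least the canonical representative -/
lemma modEq_le {n a b : ℕ} (h : a ≡ b [MOD n]) (ha : 0 < a) (hb : b ≤ n) : b ≤ a := by
  by_contra hlt
  push Not at hlt
  have h1 : n ∣ b - a := (Nat.modEq_iff_dvd' hlt.le).1 h
  have := Nat.le_of_dvd (by omega) h1
  omega

lemma modEq_lt {n a b : ℕ} (h : a ≡ b [MOD n]) (hab : b < a) : b + n ≤ a := by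
  have h1 : n ∣ a - b := (Nat.modEq_iff_dvd' hab.le).1 h.symm
  have := Nat.le_of_dvd (by omega) h1
  omega

end Sheats



namespace Sheats

lemma map_split {α β : Type*} (f : α → β) (s t : Multiset β) :
    ∀ C : Multiset α, C.map f = s + t → ∃ C1 C2, C = C1 + C2 ∧ C1.map f = s ∧ C2.map f = t := by
  classical
  induction s using Multiset.induction_on with
  | empty => intro C h; exact ⟨0, C, by simp, by simp, by simpa using h⟩
  | cons b s ih =>
    intro C h
    rw [Multiset.cons_add] at h
    obtain ⟨a, ha, hb, hm⟩ := (Multiset.map_eq_cons f C (s + t) b).2 h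
    obtain ⟨C1, C2, h1, h2, h3⟩ := ih _ hm
    refine ⟨a ::ₘ C1, C2, ?_, by simp [hb, h2], h3⟩
    rw [Multiset.cons_add, ← h1, Multiset.cons_erase ha]

lemma card_split {α : Type*} (C : Multiset α) (n : ℕ) (h : n ≤ Multiset.card C) :
    ∃ C1 C2, C = C1 + C2 ∧ Multiset.card C1 = n := by
  obtain ⟨m, hm⟩ := Nat.exists_eq_add_of_le h
  obtain ⟨C1, C2, h1, h2, h3⟩ := map_split (fun _ : α => ()) (Multiset.replicate n ()) (Multiset.replicate m ()) C (by
    rw [← Multiset.replicate_add, ← hm]; simp [Multiset.map_const'])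
  refine ⟨C1, C2, h1, ?_⟩
  have := congrArg Multiset.card h2
  simpa using this

section pack
variable {α : Type} (p f : ℕ) (ε : α → ℕ)

/-- `S` is a nonempty multiset with value congruent to `p^t` -/
def Good (t : ℕ) (S : Multiset α) : Prop := S ≠ 0 ∧ val p (S.map ε) ≡ p ^ t [MOD p ^ f - 1]

/-- `S` splits into pieces, one for each element of `h` -/
def Realizes (h : Multiset ℕ) (S : Multiset α) : Prop :=
  ∃ C : Multiset (ℕ × Multiset α), C.map (fun b => b.1 % f) = h.map (fun t => t % f) ∧
    (∀ b ∈ C, Good p f ε b.1 b.2) ∧ (C.map Prod.snd).sum = S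

variable {p f ε}

lemma Good.congr (hp : 2 ≤ p) {s t : ℕ} {S : Multiset α} (h : Good p f ε s S) (hst : s % f = t % f) : Good p f ε t S := by
  refine ⟨h.1, h.2.trans ?_⟩
  have h1 := pow_mod_modEq (f := f) hp s
  have h2 := pow_mod_modEq (f := f) hp t
  rw [← hst] at h2
  exact h1.symm.trans h2

lemma Realizes.split {h1 h2 : Multiset ℕ} {S : Multiset α} (h : Realizes p f ε (h1 + h2) S) :
    ∃ S1 S2, S = S1 + S2 ∧ Realizes p f ε h1 S1 ∧ Realizes p f ε h2 S2 := by
  obtain ⟨C, hC, hg, hs⟩ := h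
  rw [Multiset.map_add] at hC
  obtain ⟨C1, C2, rfl, e1, e2⟩ := map_split _ _ _ C hC
  refine ⟨(C1.map Prod.snd).sum, (C2.map Prod.snd).sum, by rw [← hs]; simp,
    ⟨C1, e1, fun b hb => hg b (by simp [hb]), rfl⟩, ⟨C2, e2, fun b hb => hg b (by simp [hb]), rfl⟩⟩

lemma realizes_zero {S : Multiset α} (h : Realizes p f ε 0 S) : S = 0 := by
  obtain ⟨C, hC, hg, hs⟩ := h
  simp at hC
  subst hC
  simpa using hs.symm

lemma realizes_zero' : Realizes p f ε 0 (0 : Multiset α) := ⟨0, by simp, by simp, by simp⟩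

lemma realizes_singleton (hp : 2 ≤ p) {t : ℕ} {S : Multiset α} (h : Realizes p f ε {t} S) : Good p f ε t S := by
  obtain ⟨C, hC, hg, hs⟩ := h
  simp only [Multiset.map_singleton] at hC
  obtain ⟨b, rfl, hb⟩ := Multiset.map_eq_singleton.1 hC
  simp at hs
  subst hs
  exact (hg b (by simp)).congr hp hb

lemma Good.Lam_le (hp : 2 ≤ p) (hf : 0 < f) {t : ℕ} {S : Multiset α} (h : Good p f ε t S) (i : ℕ) :
    lam p f i t ≤ Lam p f i (S.map ε) := by
  apply modEq_le (n := p ^ f - 1)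
  · have : Lam p f i (S.map ε) ≡ Lam p f i {t} [MOD p ^ f - 1] := Lam_modEq_of_val hp i (by simpa using h.2)
    simpa using this
  · exact Lam_pos hp f i (by simpa using h.1)
  · exact lam_le_q1 hp hf i t

lemma realizes_cons (hp : 2 ≤ p) {t : ℕ} {h : Multiset ℕ} {S : Multiset α} (H : Realizes p f ε (t ::ₘ h) S) :
    ∃ S1 S2, S = S1 + S2 ∧ Good p f ε t S1 ∧ Realizes p f ε h S2 := by
  rw [← Multiset.singleton_add] at H
  obtain ⟨S1, S2, e, h1, h2⟩ := H.split
  exact ⟨S1, S2, e, realizes_singleton hp h1, h2⟩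

lemma Realizes.Lam_le (hp : 2 ≤ p) (hf : 0 < f) {h : Multiset ℕ} : ∀ {S : Multiset α}, Realizes p f ε h S → ∀ i : ℕ,
    Lam p f i h ≤ Lam p f i (S.map ε) := by
  induction h using Multiset.induction_on with
  | empty => intro S H i; simp
  | cons t h ih =>
    intro S H i
    obtain ⟨S1, S2, rfl, h1, h2⟩ := realizes_cons hp H
    have := h1.Lam_le hp hf i
    have := ih h2 i
    simp; omega

lemma Realizes.val_modEq (hp : 2 ≤ p) {h : Multiset ℕ} : ∀ {S : Multiset α}, Realizes p f ε h S →
    val p (S.map ε) ≡ val p h [MOD p ^ f - 1] := by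
  induction h using Multiset.induction_on with
  | empty => intro S H; rw [realizes_zero H]; simp [Nat.ModEq]
  | cons t h ih =>
    intro S H
    obtain ⟨S1, S2, rfl, h1, h2⟩ := realizes_cons hp H
    simpa using h1.2.add (ih h2)

lemma Realizes.ne_zero (hp : 2 ≤ p) {h : Multiset ℕ} (h0 : h ≠ 0) {S : Multiset α} (H : Realizes p f ε h S) : S ≠ 0 := by
  obtain ⟨t, ht⟩ := Multiset.exists_mem_of_ne_zero h0
  obtain ⟨D, rfl⟩ := Multiset.exists_cons_of_mem ht
  obtain ⟨S1, S2, rfl, h1, h2⟩ := realizes_cons hp H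
  intro h
  exact h1.1 (by simpa using (add_eq_zero.1 h).1)

lemma cp_congr {i j : ℕ} (h : i % f = j % f) (k : ℕ) (B : Multiset ℕ) : cp f i k B = cp f j k B := by
  unfold cp
  congr 1
  ext t
  rw [Nat.add_mod, h, ← Nat.add_mod]

lemma cp_shift (hf : 0 < f) (i k : ℕ) (hk : k < f) (B : Multiset ℕ) : cp f i k B = cp f (i + (f - 1 - k)) (f - 1) B := by
  unfold cp
  congr 1
  ext t
  have e : (t + (i + (f - 1 - k))) % f = ((t + i) % f + (f - 1 - k)) % f := by
    rw [Nat.mod_add_mod]; congr 1; omega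
  rw [e]
  have := Nat.mod_lt (t + i) hf
  generalize (t + i) % f = x at *
  constructor
  · rintro rfl
    rw [Nat.mod_eq_of_lt (by omega)]; omega
  · intro h
    by_cases hx : x + (f - 1 - k) < f
    · rw [Nat.mod_eq_of_lt hx] at h; omega
    · rw [Nat.mod_eq_sub_mod (by omega), Nat.mod_eq_of_lt (by omega)] at h; omega

lemma pack_blob (hp : 2 ≤ p) (hf : 0 < f) (h : Multiset ℕ) : ∀ n, ∀ B : Multiset (ℕ × Multiset α),
    Multiset.card B = n → (∀ b ∈ B, Good p f ε b.1 b.2) → (∀ i, Lam p f i h ≤ Lam p f i (B.map Prod.fst)) →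
    ∃ S T, (B.map Prod.snd).sum = S + T ∧ Realizes p f ε h S := by
  intro n
  induction n using Nat.strong_induction_on with
  | _ n ih =>
  intro B hn hg hL
  by_cases hdir : ∀ i, cp f i (f - 1) h ≤ cp f i (f - 1) (B.map Prod.fst)
  · have hle : h.map (fun t => t % f) ≤ B.map (fun b => b.1 % f) := by
      rw [Multiset.le_iff_count]
      intro u
      by_cases hu : u < f
      · have := hdir (0 + (f - 1 - u))
        rw [← cp_shift hf 0 u hu, ← cp_shift hf 0 u hu] at this
        unfold cp at this
        rw [Multiset.countP_map, ← Multiset.countP_eq_card_filter] at this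
        rw [Multiset.count, Multiset.countP_map, Multiset.countP_map,
          ← Multiset.countP_eq_card_filter, ← Multiset.countP_eq_card_filter]
        simpa [eq_comm] using this
      · have : Multiset.count u (h.map (fun t => t % f)) = 0 := by
          rw [Multiset.count_eq_zero, Multiset.mem_map]
          rintro ⟨t, _, rfl⟩
          exact hu (Nat.mod_lt _ hf)
        omega
    obtain ⟨D, hD⟩ := Multiset.le_iff_exists_add.1 hle
    obtain ⟨C1, C2, rfl, h1, h2⟩ := map_split _ _ _ B hD
    exact ⟨(C1.map Prod.snd).sum, (C2.map Prod.snd).sum, by simp, C1, h1, fun b hb => hg b (by simp [hb]), rfl⟩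
  · push Not at hdir
    obtain ⟨i0, hi0⟩ := hdir
    have key : ∃ i, Lam p f i h + (p ^ f - 1) ≤ Lam p f i (B.map Prod.fst) ∧ p ≤ cp f i (f - 1) (B.map Prod.fst) := by
      by_contra hno
      push Not at hno
      have step : ∀ k, Lam p f (i0 + 1 + k) h + (p ^ f - 1) ≤ Lam p f (i0 + 1 + k) (B.map Prod.fst) := by
        intro k
        induction k with
        | zero =>
          have e1 := Lam_succ hp hf i0 h
          have e2 := Lam_succ hp hf i0 (B.map Prod.fst)
          have := hL i0
          rw [add_zero]
          have h3 : (p ^ f - 1) * (cp f i0 (f - 1) (B.map Prod.fst) + 1) ≤ (p ^ f - 1) * cp f i0 (f - 1) h :=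
            Nat.mul_le_mul_left _ hi0
          have h4 := Nat.mul_le_mul_left p this
          rw [mul_add] at h3
          omega
        | succ k ihk =>
          have e1 := Lam_succ hp hf (i0 + 1 + k) h
          have e2 := Lam_succ hp hf (i0 + 1 + k) (B.map Prod.fst)
          have h3 := hno _ ihk
          have h4 : (p ^ f - 1) * (cp f (i0 + 1 + k) (f - 1) (B.map Prod.fst) + 1) ≤ (p ^ f - 1) * p :=
            Nat.mul_le_mul_left _ h3
          have h5 := Nat.mul_le_mul_left p ihk
          rw [mul_add, mul_comm p (p ^ f - 1)] at h5
          rw [mul_add] at h4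
          rw [← add_assoc]
          omega
      have all : ∀ i, cp f i (f - 1) (B.map Prod.fst) ≤ p - 1 := by
        intro i
        have : i % f = (i0 + 1 + (i + (i0 + 1) * (f - 1))) % f := by
          have : i0 + 1 + (i + (i0 + 1) * (f - 1)) = i + (i0 + 1) * f := by
            obtain ⟨g, rfl⟩ : ∃ g, f = g + 1 := ⟨f - 1, by omega⟩
            simp; ring
          rw [this]; simp
        rw [cp_congr this]
        have := hno _ (step (i + (i0 + 1) * (f - 1)))
        omega
      have hD : Dig p f (B.map Prod.fst) := by
        intro i k hk
        rw [cp_shift hf i k hk]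
        exact all _
      have h1 := Dig_Lam_le hp hf hD (i0 + 1 + 0)
      have h2 := step 0
      have h3 : 0 < Lam p f (i0 + 1 + 0) h := by
        apply Lam_pos hp
        rintro rfl
        simp at hi0
      omega
    obtain ⟨i, hi1, hi2⟩ := key
    have hi2' : p ≤ Multiset.card (B.filter (fun b => (b.1 + i) % f = f - 1)) := by
      unfold cp at hi2
      rwa [Multiset.countP_map] at hi2
    obtain ⟨D, E, hDE, hD⟩ := card_split _ _ hi2'
    obtain ⟨B2, hB⟩ := Multiset.le_iff_exists_add.1 (Multiset.filter_le (fun b : ℕ × Multiset α => (b.1 + i) % f = f - 1) B)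
    have hDm : ∀ b ∈ D, (b.1 + i) % f = f - 1 := by
      intro b hb
      have : b ∈ B.filter (fun b => (b.1 + i) % f = f - 1) := by rw [hDE]; simp [hb]
      exact (Multiset.mem_filter.1 this).2
    rw [hDE, add_assoc] at hB
    generalize E + B2 = R at hB
    subst hB
    have hD0 : D ≠ 0 := by
      rintro rfl
      simp at hD; omega
    obtain ⟨b0, hb0⟩ := Multiset.exists_mem_of_ne_zero hD0
    have hcl : ∀ b ∈ D, b.1 % f = b0.1 % f := by
      intro b hb
      have h1 := hDm b hb
      have h2 := hDm b0 hb0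
      have : b.1 + i ≡ b0.1 + i [MOD f] := h1.trans h2.symm
      exact Nat.ModEq.add_right_cancel' i this
    have hval : ∀ D : Multiset (ℕ × Multiset α), (∀ b ∈ D, b.1 % f = b0.1 % f ∧ Good p f ε b.1 b.2) →
        val p ((D.map Prod.snd).sum.map ε) ≡ Multiset.card D * p ^ b0.1 [MOD p ^ f - 1] ∧
        ∀ j, Lam p f j (D.map Prod.fst) = Multiset.card D * lam p f j b0.1 := by
      intro D
      induction D using Multiset.induction_on with
      | empty => intro _; simp [Nat.ModEq]
      | cons b D ihD =>
        intro hb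
        obtain ⟨h1, h2⟩ := ihD (fun b' hb' => hb b' (by simp [hb']))
        obtain ⟨h3, h4⟩ := hb b (by simp)
        constructor
        · have := (h4.congr hp h3).2.add h1
          simpa [add_mul, add_comm] using this
        · intro j
          have : lam p f j b.1 = lam p f j b0.1 := lam_congr _ _ (by rw [Nat.add_mod, h3, ← Nat.add_mod])
          simp [this, h2 j, add_mul, add_comm]
    obtain ⟨hv1, hv2⟩ := hval D (fun b hb => ⟨hcl b hb, hg b (by simp [hb])⟩)
    rw [hD] at hv1 hv2
    have hgood : Good p f ε (b0.1 + 1) (D.map Prod.snd).sum := by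
      constructor
      · obtain ⟨D', rfl⟩ := Multiset.exists_cons_of_mem hb0
        intro h0
        simp at h0
        exact (hg b0 (by simp)).1 h0.1
      · rwa [pow_succ, mul_comm]
    obtain ⟨S, T, h1, h2⟩ := ih (Multiset.card ((b0.1 + 1, (D.map Prod.snd).sum) ::ₘ R))
      (by simp at hn ⊢; omega) ((b0.1 + 1, (D.map Prod.snd).sum) ::ₘ R) rfl
      (by
        intro b hb
        rcases Multiset.mem_cons.1 hb with rfl | hb
        · exact hgood
        · exact hg b (by simp [hb]))
      (by
        intro j
        have e1 := hL j
        have e2 := lam_succ hp hf j b0.1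
        have e3 : lam p f (j + 1) b0.1 = lam p f j (b0.1 + 1) := lam_congr _ _ (by congr 1; ring)
        simp only [Multiset.map_add, Multiset.map_cons, Lam_add, Lam_cons, hv2] at e1 ⊢
        split_ifs at e2 with hc
        · have hij : j % f = i % f := by
            have : b0.1 + j ≡ b0.1 + i [MOD f] := hc.trans (hDm b0 hb0).symm
            exact Nat.ModEq.add_left_cancel' _ this
          have hi1' := hi1
          rw [← Lam_congr p f hij, ← Lam_congr p f hij] at hi1'
          simp only [Multiset.map_add, Multiset.map_cons, Lam_add, Lam_cons, hv2] at hi1'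
          omega
        · omega)
    refine ⟨S, T, ?_, h2⟩
    rw [← h1]; simp

lemma pack (hp : 2 ≤ p) (hf : 0 < f) (h : Multiset ℕ) (V : Multiset α)
    (hL : ∀ i, Lam p f i h ≤ Lam p f i (V.map ε)) : ∃ S T, V = S + T ∧ Realizes p f ε h S := by
  obtain ⟨S, T, h1, h2⟩ := pack_blob (ε := ε) hp hf h _ (V.map (fun a => (ε a, ({a} : Multiset α)))) rfl
    (by
      intro b hb
      obtain ⟨a, ha, rfl⟩ := Multiset.mem_map.1 hb
      constructor
      · simp
      · simp; rfl)
    (by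
      intro i
      rw [Multiset.map_map]
      exact hL i)
  refine ⟨S, T, ?_, h2⟩
  rw [← h1, Multiset.map_map]
  simp

/-- packing copies of one class from the Lam value where that class is the top one -/
lemma Lam_of_top (hp : 2 ≤ p) (hf : 0 < f) {i t n : ℕ} (ht : (t + i) % f = f - 1) {V : Multiset ℕ}
    (h : n * p ^ (f - 1) ≤ Lam p f i V) (j : ℕ) : Lam p f j (n • {t}) ≤ Lam p f j V := by
  -- choose `k < f` with `j + k ≡ i`
  have hk : ∃ k, k < f ∧ (j + k) % f = i % f := by
    refine ⟨(i + j * (f - 1)) % f, Nat.mod_lt _ hf, ?_⟩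
    rw [Nat.add_mod_mod]
    have : j + (i + j * (f - 1)) = i + j * f := by
      obtain ⟨g, rfl⟩ : ∃ g, f = g + 1 := ⟨f - 1, by omega⟩
      simp; ring
    rw [this]; simp
  obtain ⟨k, hk, hjk⟩ := hk
  have h1 := Lam_succ_le hp hf j k V
  rw [Lam_congr p f hjk] at h1
  have h2 : (t + j) % f = f - 1 - k := by
    have : ((t + j) % f + k) % f = f - 1 := by
      rw [Nat.mod_add_mod, ← ht, add_assoc, Nat.add_mod, hjk, ← Nat.add_mod]
    have hx := Nat.mod_lt (t + j) hf
    generalize (t + j) % f = x at *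
    by_cases hx' : x + k < f
    · rw [Nat.mod_eq_of_lt hx'] at this; omega
    · rw [Nat.mod_eq_sub_mod (by omega), Nat.mod_eq_of_lt (by omega)] at this; omega
  rw [Lam_nsmul, Lam_singleton]
  unfold lam
  rw [h2]
  have h3 : p ^ (f - 1) = p ^ (f - 1 - k) * p ^ k := by rw [← pow_add]; congr 1; omega
  have h4 : (n * p ^ (f - 1 - k)) * p ^ k ≤ Lam p f j V * p ^ k := by
    calc _ = n * p ^ (f - 1) := by rw [h3]; ring
      _ ≤ Lam p f i V := h
      _ ≤ _ := by rw [mul_comm]; exact h1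
  exact Nat.le_of_mul_le_mul_right h4 (by positivity)

lemma Lam_of_dig (hp : 2 ≤ p) (hf : 0 < f) {V g : Multiset ℕ} (hV : V ≠ 0) (hg : Dig p f g)
    (h : val p V ≡ val p g [MOD p ^ f - 1]) (j : ℕ) : Lam p f j g ≤ Lam p f j V :=
  modEq_le (Lam_modEq_of_val hp j h) (Lam_pos hp f j hV) (Dig_Lam_le hp hf hg j)

end pack

end Sheats



namespace Sheats

/-- consecutive classes -/
def seg (c n : ℕ) : Multiset ℕ := (Multiset.range n).map (fun x => c + x)

lemma seg_succ (c n : ℕ) : seg c (n + 1) = (c + n) ::ₘ seg c n := by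
  simp [seg, Multiset.range_succ]

lemma Lam_seg_mono (p f c : ℕ) {m n : ℕ} (h : m ≤ n) (j : ℕ) : Lam p f j (seg c m) ≤ Lam p f j (seg c n) := by
  apply Lam_le
  exact Multiset.map_le_map (Multiset.range_le.2 h)

/-- an item is a pair (exponent, label) -/
abbrev Item := ℕ × ℕ

/-- basic invariant of the exchange process -/
structure Inv (p f d : ℕ) (Tot : Multiset Item) (g : ℕ → Multiset ℕ) (A : ℕ → Multiset Item) : Prop where
  tot : ∑ m ∈ Finset.range (d + 1), A m = Tot
  cap : ∀ m ≤ d, ∀ o ∈ A m, m ≤ o.2 + 1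
  cong : ∀ m < d, val p ((A m).map Prod.fst) ≡ val p (g m) [MOD p ^ f - 1]
  ne : ∀ m, 1 ≤ m → m < d → A m ≠ 0

/-- state of the exchange process -/
structure State (p f d c : ℕ) (A : ℕ → Multiset Item) (ρ β : ℕ) (Q : Multiset Item) (U : ℕ → Multiset Item) : Prop where
  sub : Q ≤ A 0
  good : Good p f Prod.fst (c + ρ) Q
  cap : ∀ o ∈ Q, β ≤ o.2 + 1
  one : 1 ≤ β
  le : β ≤ d
  Usub : ∀ m, 1 ≤ m → m < d → U m ≤ A m
  Ulab : ∀ m, 1 ≤ m → m < d → ∀ o ∈ U m, m ≤ o.2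
  Ucov : ∀ m, 1 ≤ m → m < d → ∀ j, Lam p f j (seg c (if m < β then ρ else ρ + 1)) ≤ Lam p f j ((U m).map Prod.fst)

variable {p f d c : ℕ} {Tot : Multiset Item} {g : ℕ → Multiset ℕ} {A : ℕ → Multiset Item}

/-- perform a swap between bins `0` and `b` -/
def swp (A : ℕ → Multiset Item) (b : ℕ) (X Y : Multiset Item) : ℕ → Multiset Item :=
  fun m => if m = 0 then X else if m = b then Y else A m

lemma swp_zero (b : ℕ) (X Y : Multiset Item) : swp A b X Y 0 = X := by simp [swp]
lemma swp_self {b : ℕ} (hb : 1 ≤ b) (X Y : Multiset Item) : swp A b X Y b = Y := by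
  have : b ≠ 0 := by omega
  simp [swp, this]
lemma swp_other {b m : ℕ} (hm : 1 ≤ m) (hmb : m ≠ b) (X Y : Multiset Item) : swp A b X Y m = A m := by
  have : m ≠ 0 := by omega
  simp [swp, this, hmb]

lemma sum_two {M : Type*} [AddCommMonoid M] (d b : ℕ) (hb : 1 ≤ b) (hbd : b ≤ d) (F : ℕ → M) :
    ∑ m ∈ Finset.range (d + 1), F m = F 0 + F b + ∑ m ∈ ((Finset.range (d + 1)).erase 0).erase b, F m := by
  rw [← Finset.add_sum_erase _ F (by simp : 0 ∈ Finset.range (d + 1)),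
    ← Finset.add_sum_erase _ F (by simp; omega : b ∈ (Finset.range (d + 1)).erase 0), add_assoc]

lemma Inv.swap (hA : Inv p f d Tot g A) {b : ℕ} (hb : 1 ≤ b) (hbd : b ≤ d) {Q X P Y : Multiset Item}
    (h0 : A 0 = Q + X) (hB : A b + Q = P + Y) (hcap : ∀ o ∈ Q, b ≤ o.2 + 1)
    (hval : val p (Q.map Prod.fst) ≡ val p (P.map Prod.fst) [MOD p ^ f - 1]) (hY : b < d → Y ≠ 0) :
    Inv p f d Tot g (swp A b (P + X) Y) := by
  constructor
  · rw [← hA.tot, sum_two d b hb hbd, sum_two d b hb hbd]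
    rw [swp_zero, swp_self hb]
    congr 1
    · rw [h0]
      calc P + X + Y = (P + Y) + X := by abel
        _ = (A b + Q) + X := by rw [hB]
        _ = _ := by abel
    · apply Finset.sum_congr rfl
      intro m hm
      simp at hm
      exact swp_other (by omega) hm.1 _ _
  · intro m hm o ho
    by_cases h : m = 0
    · omega
    by_cases h' : m = b
    · subst h'
      rw [swp_self hb] at ho
      have : o ∈ A m + Q := by rw [hB]; simp [ho]
      rcases Multiset.mem_add.1 this with h1 | h1
      · exact hA.cap m hm o h1
      · exact hcap o h1
    · rw [swp_other (by omega) h'] at ho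
      exact hA.cap m hm o ho
  · intro m hm
    by_cases h : m = 0
    · subst h
      rw [swp_zero]
      have := hA.cong 0 hm
      rw [h0] at this
      simp only [Multiset.map_add, val_add] at this ⊢
      exact (hval.symm.add_right _).trans this
    by_cases h' : m = b
    · subst h'
      rw [swp_self hb]
      have h1 := hA.cong m hm
      have h2 := congrArg (fun s => val p (Multiset.map Prod.fst s)) hB
      simp only [Multiset.map_add, val_add] at h2
      have h3 : val p ((A m).map Prod.fst) + val p (Q.map Prod.fst) ≡ val p (g m) + val p (P.map Prod.fst) [MOD p ^ f - 1] :=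
        h1.add hval
      rw [h2, add_comm] at h3
      exact Nat.ModEq.add_right_cancel' _ h3
    · rw [swp_other (by omega) h']
      exact hA.cong m hm
  · intro m hm hmd
    by_cases h' : m = b
    · subst h'
      rw [swp_self hb]
      exact hY hmd
    · rw [swp_other (by omega) h']
      exact hA.ne m hm hmd

lemma advance (hp : 2 ≤ p) (hf : 0 < f) (hA : Inv p f d Tot g A) {ρ β : ℕ} {Q : Multiset Item} {U : ℕ → Multiset Item}
    (hS : State p f d c A ρ β Q U) (hβ : β < d) :
    ∃ A' Q' U', Inv p f d Tot g A' ∧ State p f d c A' ρ (β + 1) Q' U' := by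
  have hcov := hS.Ucov β hS.one hβ
  simp only [lt_irrefl, if_false] at hcov
  obtain ⟨S, T, hST, hR⟩ := pack hp hf _ _ hcov
  rw [seg_succ] at hR
  obtain ⟨R, S', rfl, hgR, hS'⟩ := realizes_cons hp hR
  obtain ⟨X, hX⟩ := Multiset.le_iff_exists_add.1 hS.sub
  obtain ⟨W, hW⟩ := Multiset.le_iff_exists_add.1 (hS.Usub β hS.one hβ)
  rw [hST] at hW
  have hlab := hS.Ulab β hS.one hβ
  refine ⟨swp A β (R + X) (S' + T + W + Q), R, Function.update U β S', ?_, ?_⟩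
  · refine hA.swap hS.one hβ.le hX ?_ hS.cap (hS.good.2.trans hgR.2.symm) ?_
    · rw [hW]; abel
    · intro _ h0
      exact hS.good.1 (add_eq_zero.1 h0).2
  · constructor
    · rw [swp_zero]; exact Multiset.le_add_right _ _
    · exact hgR
    · intro o ho
      have := hlab o (by rw [hST]; simp [ho])
      omega
    · omega
    · omega
    · intro m hm hmd
      by_cases h : m = β
      · subst h
        rw [swp_self hm, Function.update_self]
        rw [add_assoc, add_assoc]
        exact Multiset.le_add_right _ _
      · rw [swp_other hm h, Function.update_of_ne h]
        exact hS.Usub m hm hmd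
    · intro m hm hmd
      by_cases h : m = β
      · subst h
        rw [Function.update_self]
        intro o ho
        exact hlab o (by rw [hST]; simp [ho])
      · rw [Function.update_of_ne h]
        exact hS.Ulab m hm hmd
    · intro m hm hmd j
      by_cases h : m = β
      · subst h
        rw [Function.update_self, if_pos (by omega)]
        exact hS'.Lam_le hp hf j
      · rw [Function.update_of_ne h]
        have := hS.Ucov m hm hmd j
        by_cases h1 : m < β
        · rw [if_pos (by omega)]; rwa [if_pos h1] at this
        · rw [if_neg (by omega)]; rwa [if_neg h1] at this

/-- the conversion in bin `b` -/
lemma convert_aux (hp : 2 ≤ p) (hf : 0 < f) {ρ i : ℕ} (hi : (c + ρ + i) % f = f - 1) {W Z : Multiset Item}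
    (hW : ∀ j, Lam p f j (seg c (ρ + 2)) ≤ Lam p f j (W.map Prod.fst)) {x : ℕ}
    (hx : Lam p f i (seg c (ρ + 1)) ≤ x)
    (hB : x + p ^ f ≤ Lam p f i ((W + Z).map Prod.fst)) :
    ∃ P U Y, W + Z = P + U + Y ∧ U ≤ W ∧ Realizes p f Prod.fst (p • {c + ρ}) P ∧
      Realizes p f Prod.fst (seg c (ρ + 1)) U := by
  obtain ⟨S, T, rfl, hR⟩ := pack hp hf _ _ hW
  rw [seg_succ] at hR
  obtain ⟨R, U', rfl, hgR, hU'⟩ := realizes_cons hp hR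
  by_cases hcase : p ^ f ≤ Lam p f i ((R + T + Z).map Prod.fst)
  · obtain ⟨P, Y, e, hP⟩ := pack (ε := Prod.fst) hp hf (p • {c + ρ}) (R + T + Z)
      (fun j => Lam_of_top hp hf hi (by rw [q_eq hp hf]; exact hcase) j)
    refine ⟨P, U', Y, ?_, ?_, hP, hU'⟩
    · calc R + U' + T + Z = (R + T + Z) + U' := by abel
        _ = _ := by rw [e]; abel
    · rw [add_comm R U', add_assoc]; exact Multiset.le_add_right _ _
  · have h1 : Lam p f i ((R + U' + T + Z).map Prod.fst) = Lam p f i ((R + T + Z).map Prod.fst) + Lam p f i (U'.map Prod.fst) := by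
      simp; ring
    have h2 : Lam p f i (seg c (ρ + 1)) < Lam p f i (U'.map Prod.fst) := by omega
    have h3 := modEq_lt (Lam_modEq_of_val hp i (hU'.val_modEq hp)) h2
    obtain ⟨S, Y, e, hS⟩ := pack (ε := Prod.fst) hp hf (p • {c + ρ} + seg c (ρ + 1)) (R + U') (by
      intro j
      have e1 := lam_succ hp hf j (c + ρ)
      have e2 : lam p f (j + 1) (c + ρ) = lam p f j (c + (ρ + 1)) := lam_congr _ _ (by congr 1; ring)
      have e3 := hgR.Lam_le hp hf j
      have e4 := hU'.Lam_le hp hf j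
      simp only [Lam_add, Lam_nsmul, Lam_singleton, Multiset.map_add]
      split_ifs at e1 with hc
      · have hij : j % f = i % f := by
          have : c + ρ + j ≡ c + ρ + i [MOD f] := hc.trans hi.symm
          exact Nat.ModEq.add_left_cancel' _ this
        rw [← Lam_congr p f hij, ← Lam_congr p f hij] at h3
        omega
      · omega)
    obtain ⟨P, U, rfl, hP, hU⟩ := hS.split
    refine ⟨P, U, Y + T + Z, ?_, ?_, hP, hU⟩
    · rw [e]; abel
    · rw [e, add_comm P U, add_assoc, add_assoc]; exact Multiset.le_add_right _ _

lemma exists_cut (hf : 0 < f) (x : ℕ) : ∃ i, (x + i) % f = f - 1 := by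
  refine ⟨x * (f - 1) + (f - 1), ?_⟩
  have : x + (x * (f - 1) + (f - 1)) = (f - 1) + f * x := by
    obtain ⟨g, rfl⟩ : ∃ g, f = g + 1 := ⟨f - 1, by omega⟩
    simp; ring
  rw [this, Nat.add_mul_mod_self_left]
  exact Nat.mod_eq_of_lt (by omega)

lemma seg_ne (c n : ℕ) : seg c (n + 1) ≠ 0 := by rw [seg_succ]; simp

theorem engine (hp : 2 ≤ p) (hf : 0 < f) {r : ℕ} {e0 : Item} (he : e0.1 = c) (he0 : e0 ∈ Tot)
    (H1 : ∀ m, 1 ≤ m → m < d → ∀ j, Lam p f j (seg c (r + 1)) ≤ Lam p f j (g m))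
    (H2 : ∀ ρ < r, ∀ i, (c + ρ + i) % f = f - 1 →
      p ^ f - 1 + ∑ m ∈ Finset.range d, Lam p f i (g m) ≤ Lam p f i (Tot.map Prod.fst)) :
    ∀ ρ ≤ r, ∀ n, ∀ A β Q U, d - β = n → Inv p f d Tot g A → State p f d c A ρ β Q U →
      ∃ A', Inv p f d Tot g A' ∧ e0 ∈ A' 0 := by
  intro ρ
  induction ρ with
  | zero =>
    intro _ n
    induction n with
    | zero =>
      intro A β Q U hn hA hS
      have hβ : β = d := by have := hS.le; omega
      rw [← hA.tot] at he0
      obtain ⟨j, hj, hj0⟩ := Multiset.mem_sum.1 he0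
      simp at hj
      by_cases hj1 : j = 0
      · subst hj1; exact ⟨A, hA, hj0⟩
      obtain ⟨W, hW⟩ := Multiset.exists_cons_of_mem hj0
      obtain ⟨X, hX⟩ := Multiset.le_iff_exists_add.1 hS.sub
      refine ⟨_, hA.swap (b := j) (P := {e0}) (Y := W + Q) (by omega) (by omega) hX ?_ ?_ ?_ ?_, ?_⟩
      · rw [hW, ← Multiset.singleton_add, add_assoc]
      · intro o ho
        have := hS.cap o ho
        omega
      · simpa [he] using hS.good.2
      · intro _ h0
        exact hS.good.1 (add_eq_zero.1 h0).2
      · rw [swp_zero]; simp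
    | succ n ihn =>
      intro A β Q U hn hA hS
      have he0' := he0
      rw [← hA.tot] at he0'
      obtain ⟨j, hj, hj0⟩ := Multiset.mem_sum.1 he0'
      simp at hj
      by_cases hj1 : j = 0
      · subst hj1; exact ⟨A, hA, hj0⟩
      by_cases hjβ : j ≤ β
      · obtain ⟨W, hW⟩ := Multiset.exists_cons_of_mem hj0
        obtain ⟨X, hX⟩ := Multiset.le_iff_exists_add.1 hS.sub
        refine ⟨_, hA.swap (b := j) (P := {e0}) (Y := W + Q) (by omega) (by omega) hX ?_ ?_ ?_ ?_, ?_⟩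
        · rw [hW, ← Multiset.singleton_add, add_assoc]
        · intro o ho
          have := hS.cap o ho
          omega
        · simpa [he] using hS.good.2
        · intro _ h0
          exact hS.good.1 (add_eq_zero.1 h0).2
        · rw [swp_zero]; simp
      · obtain ⟨A', Q', U', hA', hS'⟩ := advance hp hf hA hS (by omega)
        exact ihn A' (β + 1) Q' U' (by omega) hA' hS'
  | succ ρ ihρ =>
    intro hρ n
    obtain ⟨i, hi⟩ := exists_cut hf (c + ρ)
    have hq := q1_add (f := f) hp
    -- main step
    have main : ∀ A β Q U, Inv p f d Tot g A → State p f d c A (ρ + 1) β Q U →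
        (∃ A', Inv p f d Tot g A' ∧ e0 ∈ A' 0) ∨ β < d := by
      intro A β Q U hA hS
      have hQpos : 0 < Lam p f i (Q.map Prod.fst) := Lam_pos hp f i (by simpa using hS.good.1)
      have mono : ∀ m, 1 ≤ m → m < d → ∀ j, Lam p f j (seg c (ρ + 1)) ≤ Lam p f j ((U m).map Prod.fst) := by
        intro m hm hmd j
        refine (Lam_seg_mono p f c ?_ j).trans (hS.Ucov m hm hmd j)
        split_ifs <;> omega
      have hP : ∀ P : Multiset Item, Realizes p f Prod.fst (p • {c + ρ}) P →
          (∃ Q' P', P = Q' + P' ∧ Good p f Prod.fst (c + ρ) Q') ∧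
          val p (Q.map Prod.fst) ≡ val p (P.map Prod.fst) [MOD p ^ f - 1] := by
        intro P hP
        constructor
        · have : p • ({c + ρ} : Multiset ℕ) = (c + ρ) ::ₘ (p - 1) • {c + ρ} := by
            obtain ⟨a, rfl⟩ : ∃ a, p = a + 1 := ⟨p - 1, by omega⟩
            rw [succ_nsmul', Multiset.singleton_add]; rfl
          rw [this] at hP
          obtain ⟨Q', P', h1, h2, _⟩ := realizes_cons hp hP
          exact ⟨Q', P', h1, h2⟩
        · refine hS.good.2.trans ?_
          have := (hP.val_modEq hp).symm
          simpa [← add_assoc, pow_succ, mul_comm] using this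
      obtain ⟨X, hX⟩ := Multiset.le_iff_exists_add.1 hS.sub
      have tot : Lam p f i (Tot.map Prod.fst) = ∑ m ∈ Finset.range d, Lam p f i ((A m).map Prod.fst) + Lam p f i ((A d).map Prod.fst) := by
        rw [← hA.tot, ← Finset.sum_range_succ (fun m => Lam p f i ((A m).map Prod.fst))]
        generalize Finset.range (d + 1) = s
        classical
        induction s using Finset.induction_on with
        | empty => simp
        | insert a s ha ih => rw [Finset.sum_insert ha, Finset.sum_insert ha, Multiset.map_add, Lam_add, ih]
      have h2 := H2 ρ (by omega) i hi
      have pig : (∃ b < d, Lam p f i (g b) + (p ^ f - 1) ≤ Lam p f i ((A b).map Prod.fst)) ∨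
          p ^ f - 1 ≤ Lam p f i ((A d).map Prod.fst) := by
        by_contra hno
        push Not at hno
        have : ∑ m ∈ Finset.range d, Lam p f i ((A m).map Prod.fst) ≤ ∑ m ∈ Finset.range d, Lam p f i (g m) := by
          apply Finset.sum_le_sum
          intro m hm
          simp at hm
          by_contra hlt
          push Not at hlt
          have := modEq_lt (Lam_modEq_of_val hp i (hA.cong m hm)) hlt
          have := hno.1 m hm
          omega
        omega
      rcases pig with ⟨b, hbd, hb⟩ | hd
      · by_cases hb0 : b = 0
        · subst hb0
          left
          obtain ⟨S, T, hST, hR⟩ := pack (ε := Prod.fst) hp hf (1 • {c + ρ}) (A 0)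
            (fun j => Lam_of_top hp hf hi (by have := pow_le_q1 hp hf; omega) j)
          rw [one_smul] at hR
          refine ihρ (by omega) _ A 1 S U rfl hA ⟨?_, realizes_singleton hp hR, ?_, le_rfl, ?_, hS.Usub, hS.Ulab, ?_⟩
          · rw [hST]; exact Multiset.le_add_right _ _
          · intro o _; omega
          · have := hS.one; have := hS.le; omega
          · intro m hm hmd j
            rw [if_neg (by omega)]
            exact mono m hm hmd j
        · by_cases hbβ : b ≤ β
          · left
            have hb1 : 1 ≤ b := by omega
            obtain ⟨W0, hW0⟩ := Multiset.le_iff_exists_add.1 (hS.Usub b hb1 hbd)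
            obtain ⟨W, Z, hWZ, hWlab, hWcov⟩ : ∃ W Z, A b + Q = W + Z ∧ (∀ o ∈ W, b ≤ o.2) ∧
                ∀ j, Lam p f j (seg c (ρ + 2)) ≤ Lam p f j (W.map Prod.fst) := by
              by_cases hlt : b < β
              · refine ⟨U b + Q, W0, ?_, ?_, ?_⟩
                · rw [hW0]; abel
                · intro o ho
                  rcases Multiset.mem_add.1 ho with h1 | h1
                  · exact hS.Ulab b hb1 hbd o h1
                  · have := hS.cap o h1; omega
                · intro j
                  have e1 := hS.Ucov b hb1 hbd j
                  rw [if_pos hlt] at e1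
                  have e2 := hS.good.Lam_le hp hf j
                  rw [seg_succ]
                  simp only [Lam_cons, Multiset.map_add, Lam_add]
                  omega
              · refine ⟨U b, W0 + Q, ?_, hS.Ulab b hb1 hbd, ?_⟩
                · rw [hW0]; abel
                · intro j
                  have e1 := hS.Ucov b hb1 hbd j
                  rwa [if_neg hlt] at e1
            obtain ⟨P, U', Y, e, hUW, hPr, hUr⟩ := convert_aux hp hf hi (Z := Z) hWcov
              ((Lam_seg_mono p f c (by omega : ρ + 1 ≤ r + 1) i).trans (H1 b hb1 hbd i)) (by
                rw [← hWZ, Multiset.map_add, Lam_add]; omega)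
            obtain ⟨⟨Q', P', rfl, hQ'⟩, hv⟩ := hP P hPr
            have hU'0 : U' ≠ 0 := hUr.ne_zero hp (seg_ne _ _)
            refine ihρ (by omega) _ (swp A b (Q' + P' + X) (U' + Y)) b Q' (Function.update U b U') rfl
              (hA.swap hb1 hbd.le hX (by rw [hWZ, e]; abel) (fun o ho => hbβ.trans (hS.cap o ho)) hv
                (fun _ h0 => hU'0 (add_eq_zero.1 h0).1)) ⟨?_, hQ', ?_, hb1, hbd.le, ?_, ?_, ?_⟩
            · rw [swp_zero, add_assoc]; exact Multiset.le_add_right _ _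
            · intro o ho
              have : o ∈ A b + Q := by rw [hWZ, e]; simp [ho]
              rcases Multiset.mem_add.1 this with h1 | h1
              · exact hA.cap b hbd.le o h1
              · exact hbβ.trans (hS.cap o h1)
            · intro m hm hmd
              by_cases h : m = b
              · subst h
                rw [swp_self hm, Function.update_self]
                exact Multiset.le_add_right _ _
              · rw [swp_other hm h, Function.update_of_ne h]
                exact hS.Usub m hm hmd
            · intro m hm hmd
              by_cases h : m = b
              · subst h
                rw [Function.update_self]
                intro o ho
                exact hWlab o (Multiset.mem_of_le hUW ho)
              · rw [Function.update_of_ne h]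
                exact hS.Ulab m hm hmd
            · intro m hm hmd j
              refine (Lam_seg_mono p f c (by split_ifs <;> omega : _ ≤ ρ + 1) j).trans ?_
              by_cases h : m = b
              · subst h
                rw [Function.update_self]
                exact hUr.Lam_le hp hf j
              · rw [Function.update_of_ne h]
                exact mono m hm hmd j
          · right; omega
      · by_cases hβd : β < d
        · right; exact hβd
        left
        have hβd : β = d := by have := hS.le; omega
        have hd1 : 1 ≤ d := hβd ▸ hS.one
        obtain ⟨P, Y, e, hPr⟩ := pack (ε := Prod.fst) hp hf (p • {c + ρ}) (A d + Q)
          (fun j => Lam_of_top hp hf hi (by rw [q_eq hp hf, Multiset.map_add, Lam_add]; omega) j)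
        obtain ⟨⟨Q', P', rfl, hQ'⟩, hv⟩ := hP P hPr
        refine ihρ (by omega) _ (swp A d (Q' + P' + X) Y) d Q' U rfl
          (hA.swap hd1 le_rfl hX e (fun o ho => hβd ▸ hS.cap o ho) hv
            (fun h => absurd h (lt_irrefl _))) ⟨?_, hQ', ?_, hd1, le_rfl, ?_, hS.Ulab, ?_⟩
        · rw [swp_zero, add_assoc]; exact Multiset.le_add_right _ _
        · intro o ho
          have : o ∈ A d + Q := by rw [e]; simp [ho]
          rcases Multiset.mem_add.1 this with h1 | h1
          · exact hA.cap d le_rfl o h1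
          · exact hβd ▸ hS.cap o h1
        · intro m hm hmd
          rw [swp_other hm hmd.ne]
          exact hS.Usub m hm hmd
        · intro m hm hmd j
          exact (Lam_seg_mono p f c (by split_ifs <;> omega : _ ≤ ρ + 1) j).trans (mono m hm hmd j)
    induction n with
    | zero =>
      intro A β Q U hn hA hS
      rcases main A β Q U hA hS with h | h
      · exact h
      · omega
    | succ n ihn =>
      intro A β Q U hn hA hS
      rcases main A β Q U hA hS with h | h
      · exact h
      · obtain ⟨A', Q', U', hA', hS'⟩ := advance hp hf hA hS h
        exact ihn A' (β + 1) Q' U' (by omega) hA' hS'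

end Sheats



namespace Sheats

variable {p f : ℕ}

lemma cp_eq_card (i k : ℕ) (B : Multiset ℕ) : cp f i k B = Multiset.card (B.filter (fun t => (t + i) % f = k)) := by
  unfold cp; rw [Multiset.countP_eq_card_filter]

lemma Dig_of_window {lo : ℕ} {B : Multiset ℕ} (hc : ∀ t, B.count t ≤ p - 1)
    (hw : ∀ t ∈ B, lo ≤ t ∧ t < lo + f) : Dig p f B := by
  intro i k hk
  by_cases h : ∃ t ∈ B, (t + i) % f = k
  · obtain ⟨t0, ht0, hk0⟩ := h
    have : cp f i k B ≤ B.count t0 := by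
      unfold cp Multiset.count
      rw [Multiset.countP_eq_card_filter, Multiset.countP_eq_card_filter]
      apply Multiset.card_le_card
      rw [Multiset.filter_congr (q := fun x => t0 = x)]
      intro t ht
      constructor
      · intro h
        have : t0 + i ≡ t + i [MOD f] := hk0.trans h.symm
        have : t0 ≡ t [MOD f] := Nat.ModEq.add_right_cancel' i this
        have h1 := hw t ht
        have h2 := hw t0 ht0
        rcases le_total t0 t with h3 | h3
        · have h4 := (Nat.modEq_iff_dvd' h3).1 this
          have := Nat.eq_zero_of_dvd_of_lt h4 (by omega)
          omega
        · have h4 := (Nat.modEq_iff_dvd' h3).1 this.symm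
          have := Nat.eq_zero_of_dvd_of_lt h4 (by omega)
          omega
      · rintro rfl; exact hk0
    exact this.trans (hc t0)
  · push Not at h
    have : cp f i k B = 0 := by
      unfold cp
      rw [Multiset.countP_eq_zero]
      exact h
    omega

/-- all classes `p-1` times -/
def full (p f : ℕ) : Multiset ℕ := (p - 1) • Multiset.range f

lemma val_range (hp : 2 ≤ p) (n : ℕ) : val p ((p - 1) • Multiset.range n) = p ^ n - 1 := by
  have := geom p n hp
  rw [val_nsmul]
  have h : val p (Multiset.range n) = ∑ k ∈ Finset.range n, p ^ k := rfl
  rw [h, Finset.mul_sum]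
  omega

lemma val_full (hp : 2 ≤ p) : val p (full p f) = p ^ f - 1 := val_range hp f

lemma count_range_le (n t : ℕ) : (Multiset.range n).count t ≤ 1 :=
  Multiset.nodup_iff_count_le_one.1 (Multiset.nodup_range n) t

lemma count_full_le (t : ℕ) : (full p f).count t ≤ p - 1 := by
  unfold full
  rw [Multiset.count_nsmul]
  have := Nat.mul_le_mul_left (p - 1) (count_range_le f t)
  omega

lemma Dig_full : Dig p f (full p f) := by
  apply Dig_of_window (lo := 0) (fun t => count_full_le t)
  intro t ht
  unfold full at ht
  have := Multiset.mem_of_mem_nsmul ht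
  simp at this
  omega

lemma q1_pos (hp : 2 ≤ p) (hf : 0 < f) : 0 < p ^ f - 1 := by
  have := pow_le_q1 hp hf
  have : 0 < p ^ (f - 1) := by positivity
  omega

lemma full_ne (hp : 2 ≤ p) (hf : 0 < f) : full p f ≠ 0 := by
  intro h
  have := val_full (f := f) hp
  rw [h] at this
  have := q1_pos hp hf
  simp at *
  omega

lemma Lam_full (hp : 2 ≤ p) (hf : 0 < f) (i : ℕ) : Lam p f i (full p f) = p ^ f - 1 := by
  apply le_antisymm
  · exact Dig_Lam_le hp hf Dig_full i
  · exact q1_le_Lam hp i (full_ne hp hf) (by rw [val_full hp])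

lemma Lam_map_mod (i : ℕ) (B : Multiset ℕ) : Lam p f i (B.map (fun t => t % f)) = Lam p f i B := by
  unfold Lam
  rw [Multiset.map_map]
  congr 1
  apply Multiset.map_congr rfl
  intro t _
  apply lam_congr; simp

lemma Lam_le_of_classes {B C : Multiset ℕ} (h : B.map (fun t => t % f) ≤ C.map (fun t => t % f)) (i : ℕ) :
    Lam p f i B ≤ Lam p f i C := by
  rw [← Lam_map_mod i B, ← Lam_map_mod i C]
  exact Lam_le p f i h

lemma exists_compl (hp : 2 ≤ p) (hf : 0 < f) {a : Multiset ℕ} (ha : Dig p f a) :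
    ∃ g, ∀ s, Lam p f s a + Lam p f s g = p ^ f - 1 := by
  have hle : a.map (fun t => t % f) ≤ full p f := by
    rw [Multiset.le_iff_count]
    intro u
    by_cases hu : u < f
    · have h1 := ha 0 u hu
      unfold cp at h1
      rw [Multiset.count, Multiset.countP_map, ← Multiset.countP_eq_card_filter]
      have h2 : (full p f).count u = p - 1 := by
        unfold full
        rw [Multiset.count_nsmul, Multiset.count_eq_one_of_mem (Multiset.nodup_range f) (by simpa using hu), mul_one]
      change _ ≤ (full p f).count u
      rw [h2]
      simpa [eq_comm] using h1
    · have : Multiset.count u (a.map (fun t => t % f)) = 0 := by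
        rw [Multiset.count_eq_zero, Multiset.mem_map]
        rintro ⟨t, _, rfl⟩
        exact hu (Nat.mod_lt _ hf)
      omega
  obtain ⟨g, hg⟩ := Multiset.le_iff_exists_add.1 hle
  refine ⟨g, fun s => ?_⟩
  rw [← Lam_full hp hf s, hg, Lam_add, Lam_map_mod]

/-- digit multiset of a number at cut `i` -/
def digs (p f i n : ℕ) : Multiset ℕ := ∑ k ∈ Finset.range f, (n / p ^ k % p) • {k + i * (f - 1)}

lemma digs_pos (hf : 0 < f) (i k : ℕ) (hk : k < f) : (k + i * (f - 1) + i) % f = k := by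
  have : k + i * (f - 1) + i = k + f * i := by
    obtain ⟨g, rfl⟩ : ∃ g, f = g + 1 := ⟨f - 1, by omega⟩
    simp; ring
  rw [this, Nat.add_mul_mod_self_left, Nat.mod_eq_of_lt hk]

lemma mem_digs {i n t : ℕ} (h : t ∈ digs p f i n) : ∃ k < f, t = k + i * (f - 1) := by
  unfold digs at h
  obtain ⟨k, hk, hk'⟩ := Multiset.mem_sum.1 h
  refine ⟨k, by simpa using hk, ?_⟩
  simpa using Multiset.mem_of_mem_nsmul hk'

lemma count_digs {i n : ℕ} (k : ℕ) (hk : k < f) : (digs p f i n).count (k + i * (f - 1)) = n / p ^ k % p := by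
  unfold digs
  rw [Multiset.count_sum']
  simp only [Multiset.count_nsmul, Multiset.count_singleton, add_left_inj, mul_ite, mul_one, mul_zero]
  rw [Finset.sum_ite_eq]
  simp [hk]

lemma Dig_digs (hp : 2 ≤ p) (i n : ℕ) : Dig p f (digs p f i n) := by
  apply Dig_of_window (lo := i * (f - 1))
  · intro t
    by_cases ht : t ∈ digs p f i n
    · obtain ⟨k, hk, rfl⟩ := mem_digs ht
      rw [count_digs k hk]
      have := Nat.mod_lt (n / p ^ k) (by omega : 0 < p)
      omega
    · rw [Multiset.count_eq_zero_of_notMem ht]; omega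
  · intro t ht
    obtain ⟨k, hk, rfl⟩ := mem_digs ht
    omega

lemma digit_sum (n : ℕ) (m : ℕ) : ∑ k ∈ Finset.range m, n / p ^ k % p * p ^ k = n % p ^ m := by
  induction m with
  | zero => simp [Nat.mod_one]
  | succ m ih => rw [Finset.sum_range_succ, ih, Nat.mod_pow_succ]; ring

lemma Lam_sum {ι : Type*} (s : Finset ι) (F : ι → Multiset ℕ) (i : ℕ) :
    Lam p f i (∑ m ∈ s, F m) = ∑ m ∈ s, Lam p f i (F m) := by
  classical
  induction s using Finset.induction_on with
  | empty => simp
  | insert a s ha ih => rw [Finset.sum_insert ha, Finset.sum_insert ha, Lam_add, ih]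

lemma val_sum {ι : Type*} (s : Finset ι) (F : ι → Multiset ℕ) :
    val p (∑ m ∈ s, F m) = ∑ m ∈ s, val p (F m) := by
  classical
  induction s using Finset.induction_on with
  | empty => simp
  | insert a s ha ih => rw [Finset.sum_insert ha, Finset.sum_insert ha, val_add, ih]

lemma Lam_digs (hf : 0 < f) {i n : ℕ} (hn : n < p ^ f) : Lam p f i (digs p f i n) = n := by
  unfold digs
  rw [Lam_sum]
  conv_rhs => rw [← Nat.mod_eq_of_lt hn, ← digit_sum n f]
  apply Finset.sum_congr rfl
  intro k hk
  rw [Lam_nsmul, Lam_singleton, lam, digs_pos hf i k (by simpa using hk)]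

/-- digit multisets covering a segment -/
lemma cover (hp : 2 ≤ p) (hf : 0 < f) {c i r n x : ℕ} (hr : (c + i) % f + r < f) (hn : n < p ^ f)
    (hx : x ≤ p - 2) (hdvd : p ^ ((c + i) % f + r + 1) ∣ n + 1 + x * p ^ ((c + i) % f)) :
    ∀ j, Lam p f j (seg c (r + 1)) ≤ Lam p f j (digs p f i n) := by
  apply Lam_le_of_classes
  set π := (c + i) % f with hπ
  rw [Multiset.le_iff_subset]
  · intro u hu
    simp only [seg, Multiset.map_map, Multiset.mem_map, Multiset.mem_range] at hu
    obtain ⟨y, hy, rfl⟩ := hu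
    simp only [Function.comp]
    have hk : π + y < f := by omega
    have hdig : n / p ^ (π + y) % p ≠ 0 := by
      intro h0
      have h1 : n % p ^ (π + y + 1) < p ^ (π + y) := by
        rw [Nat.mod_pow_succ, h0, mul_zero, add_zero]
        exact Nat.mod_lt _ (by positivity)
      have h2 : p ^ (π + y + 1) ∣ n % p ^ (π + y + 1) + 1 + x * p ^ π := by
        have h3 : p ^ (π + y + 1) ∣ n + 1 + x * p ^ π := (pow_dvd_pow p (by omega)).trans hdvd
        rw [← Nat.mod_add_div n (p ^ (π + y + 1))] at h3
        have h4 : n % p ^ (π + y + 1) + p ^ (π + y + 1) * (n / p ^ (π + y + 1)) + 1 + x * p ^ π =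
          p ^ (π + y + 1) * (n / p ^ (π + y + 1)) + (n % p ^ (π + y + 1) + 1 + x * p ^ π) := by ring
        rw [h4] at h3
        exact (Nat.dvd_add_right (Dvd.intro _ rfl)).1 h3
      have h3 := Nat.le_of_dvd (by positivity) h2
      have h4 : x * p ^ π ≤ (p - 2) * p ^ (π + y) :=
        Nat.mul_le_mul hx (Nat.pow_le_pow_right (by omega) (by omega))
      obtain ⟨b, rfl⟩ : ∃ b, p = b + 2 := ⟨p - 2, by omega⟩
      have h5 : (b + 2) ^ (π + y + 1) = (b + 2) ^ (π + y) * (b + 2) := pow_succ _ _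
      simp only [Nat.add_sub_cancel] at h4
      have h6 : 0 < (b + 2) ^ (π + y) := by positivity
      generalize n % (b + 2) ^ (π + y + 1) = z at *
      rw [h5, mul_add] at h3
      rw [mul_comm b] at h4
      omega
    rw [Multiset.mem_map]
    refine ⟨π + y + i * (f - 1), ?_, ?_⟩
    · rw [← Multiset.count_pos, count_digs _ hk]
      omega
    · have h1 := digs_pos hf i (π + y) hk
      have h2 : (c + y + i) % f = π + y := by
        have : c + y + i = (c + i) + y := by ring
        rw [this, ← Nat.mod_add_mod, Nat.mod_eq_of_lt hk]
      have : π + y + i * (f - 1) + i ≡ c + y + i [MOD f] := h1.trans h2.symm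
      exact Nat.ModEq.add_right_cancel' i this
  · simp only [seg, Multiset.map_map]
    apply Multiset.Nodup.map_on _ (Multiset.nodup_range _)
    intro x hx y hy hxy
    simp only [Function.comp, Multiset.mem_range] at *
    have h1 : x ≡ y [MOD f] := Nat.ModEq.add_left_cancel' c hxy
    unfold Nat.ModEq at h1
    rwa [Nat.mod_eq_of_lt (by omega), Nat.mod_eq_of_lt (by omega)] at h1

/-! ### values -/

lemma val_eq_sum {B : Multiset ℕ} {e : ℕ} (h : ∀ t ∈ B, t < e) :
    val p B = ∑ t ∈ Finset.range e, B.count t * p ^ t := by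
  unfold val
  rw [Finset.sum_multiset_map_count]
  simp only [smul_eq_mul]
  apply Finset.sum_subset
  · intro t ht
    simp at ht ⊢
    exact h t ht
  · intro t _ ht
    simp at ht
    simp [ht]

lemma val_lt (hp : 2 ≤ p) {B : Multiset ℕ} {e : ℕ} (hc : ∀ t, B.count t ≤ p - 1) (h : ∀ t ∈ B, t < e) :
    val p B < p ^ e := by
  rw [val_eq_sum h, ← geom p e hp, Nat.lt_succ_iff]
  apply Finset.sum_le_sum
  intro t _
  exact Nat.mul_le_mul_right _ (hc t)

lemma split3 (B : Multiset ℕ) (e : ℕ) : B = B.filter (fun t => e < t) + B.count e • {e} + B.filter (fun t => t < e) := by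
  ext t
  simp only [Multiset.count_add, Multiset.count_filter, Multiset.count_nsmul, Multiset.count_singleton]
  rcases lt_trichotomy t e with h | h | h
  · simp [h, h.ne, h.le]
  · subst h; simp
  · simp [h, h.ne', h.le]

lemma lt_of_top (hp : 2 ≤ p) {X Y : Multiset ℕ} (hX : ∀ t, X.count t ≤ p - 1) {e : ℕ}
    (he : X.count e < Y.count e) (hgt : ∀ t, e < t → X.count t = Y.count t) : val p X < val p Y := by
  have h1 : X.filter (fun t => e < t) = Y.filter (fun t => e < t) := by
    ext t
    simp only [Multiset.count_filter]
    split_ifs with h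
    · exact hgt t h
    · rfl
  rw [split3 X e, split3 Y e, h1]
  simp only [val_add, val_nsmul, val_singleton]
  have h2 : val p (X.filter (fun t => t < e)) < p ^ e := by
    apply val_lt hp
    · intro t; exact (Multiset.count_le_of_le t (Multiset.filter_le _ _)).trans (hX t)
    · intro t ht; exact (Multiset.mem_filter.1 ht).2
  have h3 : (X.count e + 1) * p ^ e ≤ Y.count e * p ^ e := Nat.mul_le_mul_right _ he
  rw [add_mul] at h3
  omega

lemma exists_top {X Y : Multiset ℕ} (h : X ≠ Y) : ∃ e, X.count e ≠ Y.count e ∧ ∀ t, e < t → X.count t = Y.count t := by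
  let s := (X + Y).toFinset.filter (fun t => X.count t ≠ Y.count t)
  have hs : s.Nonempty := by
    by_contra hne
    apply h
    ext t
    by_contra ht
    have : t ∈ s := by
      simp only [s, Finset.mem_filter, Multiset.mem_toFinset, Multiset.mem_add]
      refine ⟨?_, ht⟩
      by_contra hno
      push Not at hno
      rw [Multiset.count_eq_zero_of_notMem hno.1, Multiset.count_eq_zero_of_notMem hno.2] at ht
      exact ht rfl
    exact hne ⟨t, this⟩
  refine ⟨s.max' hs, (Finset.mem_filter.1 (s.max'_mem hs)).2, ?_⟩
  intro t ht
  by_contra hne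
  have : t ∈ s := by
    simp only [s, Finset.mem_filter, Multiset.mem_toFinset, Multiset.mem_add]
    refine ⟨?_, hne⟩
    by_contra hno
    push Not at hno
    rw [Multiset.count_eq_zero_of_notMem hno.1, Multiset.count_eq_zero_of_notMem hno.2] at hne
    exact hne rfl
  have := s.le_max' t this
  omega

lemma val_inj (hp : 2 ≤ p) {X Y : Multiset ℕ} (hX : ∀ t, X.count t ≤ p - 1) (hY : ∀ t, Y.count t ≤ p - 1)
    (h : val p X = val p Y) : X = Y := by
  by_contra hne
  obtain ⟨e, he, hgt⟩ := exists_top hne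
  rcases lt_or_gt_of_ne he with h1 | h1
  · have := lt_of_top hp hX h1 hgt; omega
  · have := lt_of_top hp hY h1 (fun t ht => (hgt t ht).symm); omega

/-! ### compositions -/

structure IsComp (p f d : ℕ) (K : Multiset ℕ) (Y : ℕ → Multiset ℕ) : Prop where
  tot : ∑ m ∈ Finset.range (d + 1), Y m = K
  ne : ∀ m < d, Y m ≠ 0
  dvd : ∀ m < d, p ^ f - 1 ∣ val p (Y m)

/-- weight -/
def wt (p d : ℕ) (Y : ℕ → Multiset ℕ) : ℕ := ∑ m ∈ Finset.range (d + 1), m * val p (Y m)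

/-- prepend -/
def consF (a : Multiset ℕ) (Y : ℕ → Multiset ℕ) : ℕ → Multiset ℕ
  | 0 => a
  | m + 1 => Y m

lemma IsComp.cons {n : ℕ} {R a : Multiset ℕ} {Y : ℕ → Multiset ℕ} (h : IsComp p f n R Y) (ha : a ≠ 0)
    (hd : p ^ f - 1 ∣ val p a) : IsComp p f (n + 1) (a + R) (consF a Y) := by
  constructor
  · rw [Finset.sum_range_succ', add_comm, ← h.tot]; rfl
  · intro m hm
    cases m with
    | zero => exact ha
    | succ m => exact h.ne m (by omega)
  · intro m hm
    cases m with
    | zero => exact hd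
    | succ m => exact h.dvd m (by omega)

lemma wt_shift (n : ℕ) (F : ℕ → Multiset ℕ) :
    wt p (n + 1) F = wt p n (fun m => F (m + 1)) + val p (∑ m ∈ Finset.range (n + 1), F (m + 1)) := by
  unfold wt
  rw [Finset.sum_range_succ', val_sum, ← Finset.sum_add_distrib]
  simp [add_mul]

lemma wt_cons {n : ℕ} {R a : Multiset ℕ} {Y : ℕ → Multiset ℕ} (h : IsComp p f n R Y) :
    wt p (n + 1) (consF a Y) = wt p n Y + val p R := by
  rw [wt_shift, ← h.tot]; rfl

lemma fulls (hp : 2 ≤ p) (hf : 0 < f) (n : ℕ) : ∀ (S T : Multiset ℕ), Realizes p f id (n • full p f) S →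
    ∃ Y, IsComp p f n (S + T) Y := by
  induction n with
  | zero =>
    intro S T h
    rw [zero_smul] at h
    rw [realizes_zero h]
    exact ⟨fun _ => T, by simp, by simp, by simp⟩
  | succ n ih =>
    intro S T h
    rw [succ_nsmul'] at h
    obtain ⟨S1, S2, rfl, h1, h2⟩ := h.split
    obtain ⟨Y, hY⟩ := ih S2 T h2
    refine ⟨consF S1 Y, ?_⟩
    · rw [add_assoc]
      apply hY.cons (h1.ne_zero hp (full_ne hp hf))
      have := h1.val_modEq hp
      rw [Multiset.map_id, val_full hp] at this
      exact (Nat.modEq_zero_iff_dvd.1 (this.trans (by simp [Nat.ModEq])))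

lemma pack_comp (hp : 2 ≤ p) (hf : 0 < f) (h K : Multiset ℕ) (n : ℕ)
    (hL : ∀ i, Lam p f i h + n * (p ^ f - 1) ≤ Lam p f i K) :
    ∃ S R Y, K = S + R ∧ Realizes p f id h S ∧ IsComp p f n R Y := by
  obtain ⟨S, T, e, hR⟩ := pack (ε := id) hp hf (h + n • full p f) K (by
    intro i
    rw [Lam_add, Lam_nsmul, Lam_full hp hf, Multiset.map_id]
    exact hL i)
  obtain ⟨S1, S2, rfl, h1, h2⟩ := hR.split
  obtain ⟨Y, hY⟩ := fulls hp hf n S2 T h2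
  exact ⟨S1, S2 + T, Y, by rw [e, add_assoc], h1, hY⟩

/-- comp has large Lam -/
lemma IsComp.Lam_ge (hp : 2 ≤ p) {n : ℕ} {R : Multiset ℕ} {Y : ℕ → Multiset ℕ} (h : IsComp p f n R Y) (i : ℕ) :
    n * (p ^ f - 1) ≤ Lam p f i R := by
  rw [← h.tot, Lam_sum, Finset.sum_range_succ]
  have : ∑ m ∈ Finset.range n, (p ^ f - 1) ≤ ∑ m ∈ Finset.range n, Lam p f i (Y m) := by
    apply Finset.sum_le_sum
    intro m hm
    simp at hm
    exact q1_le_Lam hp i (h.ne m hm) (h.dvd m hm)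
  simp at this
  omega

/-! ### window lemma -/

lemma window_step (hp : 2 ≤ p) (hf : 0 < f) {n F : ℕ} {T : Multiset ℕ} (hc : ∀ t, T.count t ≤ p - 1)
    (hF : ∀ t ∈ T, t < F) (hL : ∀ s, (n + 1) * (p ^ f - 1) ≤ Lam p f s T) :
    ∃ Y0 T1, T = Y0 + T1 ∧ T.filter (fun t => F - f ≤ t) ≤ Y0 ∧ Y0 ≠ 0 ∧ p ^ f - 1 ∣ val p Y0 ∧
      (∀ s, n * (p ^ f - 1) ≤ Lam p f s T1) := by
  obtain ⟨V, hV⟩ := Multiset.le_iff_exists_add.1 (Multiset.filter_le (fun t => F - f ≤ t) T)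
  set a := T.filter (fun t => F - f ≤ t) with ha
  have hDa : Dig p f a := by
    apply Dig_of_window (lo := F - f)
    · intro t; exact (Multiset.count_le_of_le t (Multiset.filter_le _ _)).trans (hc t)
    · intro t ht
      rw [ha, Multiset.mem_filter] at ht
      have := hF t ht.1
      omega
  obtain ⟨g, hg⟩ := exists_compl hp hf hDa
  obtain ⟨S, R, Y, e, hS, hY⟩ := pack_comp hp hf g V n (by
    intro i
    have h1 := hL i
    have h2 := hg i
    rw [hV, Lam_add, add_mul] at h1
    omega)
  refine ⟨a + S, R, ?_, Multiset.le_add_right _ _, ?_, ?_, fun s => hY.Lam_ge hp s⟩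
  · rw [hV, e, add_assoc]
  · intro h0
    rw [add_eq_zero] at h0
    have h1 := hg 0
    rw [h0.1] at h1
    have h2 := hS.Lam_le hp hf 0
    rw [h0.2] at h2
    have := q1_pos hp hf
    simp at h1 h2
    omega
  · apply dvd_val_of_Lam hp hf 0
    have h1 := Lam_modEq_of_val hp 0 (hS.val_modEq hp)
    rw [Multiset.map_id] at h1
    rw [Lam_add]
    have h2 := h1.add_left (Lam p f 0 a)
    rw [hg] at h2
    exact (Nat.modEq_zero_iff_dvd.1 (h2.trans (by simp [Nat.ModEq])))

lemma window (hp : 2 ≤ p) (hf : 0 < f) : ∀ n F (T : Multiset ℕ), (∀ t, T.count t ≤ p - 1) →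
    (∀ t ∈ T, t < F) → (∀ s, n * (p ^ f - 1) ≤ Lam p f s T) →
    ∃ Y, IsComp p f n T Y ∧ (p ^ f - 1) * wt p n Y + 1 ≤ p ^ F := by
  intro n
  induction n with
  | zero =>
    intro F T _ _ _
    refine ⟨fun _ => T, ⟨by simp, by simp, by simp⟩, ?_⟩
    have : 0 < p ^ F := by positivity
    simp [wt]; omega
  | succ n ih =>
    intro F T hc hF hL
    obtain ⟨Y0, T1, e, hw, h0, hd, hL1⟩ := window_step hp hf hc hF hL
    have hT1 : T1 ≤ T := by rw [e]; exact Multiset.le_add_left _ _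
    have hc1 : ∀ t, T1.count t ≤ p - 1 := fun t => (Multiset.count_le_of_le t hT1).trans (hc t)
    have hF1 : ∀ t ∈ T1, t < F - f := by
      intro t ht
      by_contra hlt
      push Not at hlt
      have h1 := Multiset.count_le_of_le t hw
      rw [Multiset.count_filter, if_pos hlt, e, Multiset.count_add] at h1
      have := Multiset.count_pos.2 ht
      omega
    obtain ⟨Y, hY, hwt⟩ := ih (F - f) T1 hc1 hF1 hL1
    have hv := val_lt hp hc1 hF1
    refine ⟨consF Y0 Y, by rw [e]; exact hY.cons h0 hd, ?_⟩
    rw [wt_cons hY, mul_add]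
    have hq := q1_add (f := f) hp
    by_cases hfF : f ≤ F
    · have h1 : p ^ F = p ^ f * p ^ (F - f) := by rw [← pow_add]; congr 1; omega
      rw [h1, ← hq, Nat.add_mul, one_mul]
      have : (p ^ f - 1) * val p T1 ≤ (p ^ f - 1) * p ^ (F - f) := Nat.mul_le_mul_left _ hv.le
      rw [hq]
      omega
    · have h1 : F - f = 0 := by omega
      rw [h1, pow_zero] at hv hwt
      have : 0 < p ^ F := by positivity
      have h2 : val p T1 = 0 := by omega
      rw [h2]; omega

end Sheats



namespace Sheats

variable {p f : ℕ}

lemma reject (hp : 2 ≤ p) (hf : 0 < f) {n : ℕ} {K M0 b : Multiset ℕ}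
    (hmax : ∀ Y, IsComp p f (n + 1) K Y → val p (Y 0) ≤ val p M0) (hb : b ≤ K) (hlt : val p M0 < val p b) :
    ∃ i κ, p ^ f - 1 ∣ κ ∧ κ < Lam p f i b ∧ Lam p f i K < (n + 1) * (p ^ f - 1) + κ := by
  by_contra hno
  push Not at hno
  have hq := q1_pos hp hf
  have hq1 := q1_add (f := f) hp
  have hb0 : b ≠ 0 := by rintro rfl; simp at hlt
  set n0 := (p ^ f - 1 - Lam p f 0 b % (p ^ f - 1)) % (p ^ f - 1) with hn0
  have hn0lt : n0 < p ^ f - 1 := Nat.mod_lt _ hq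
  set h := digs p f 0 n0 with hh
  have hDh : Dig p f h := Dig_digs hp 0 n0
  have hL0 : Lam p f 0 h = n0 := Lam_digs hf (by omega)
  have hdvd0 : p ^ f - 1 ∣ Lam p f 0 (b + h) := by
    rw [Lam_add, hL0, Nat.dvd_iff_mod_eq_zero, hn0, Nat.add_mod_mod, ← Nat.mod_add_mod]
    have := Nat.mod_lt (Lam p f 0 b) hq
    rw [Nat.add_sub_of_le this.le, Nat.mod_self]
  have hdvd : p ^ f - 1 ∣ val p (b + h) := dvd_val_of_Lam hp hf 0 hdvd0
  have hLh : ∀ i, Lam p f i h < p ^ f - 1 := by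
    intro i
    have h1 := Dig_Lam_le hp hf hDh i
    refine lt_of_le_of_ne h1 ?_
    intro h2
    have h3 : p ^ f - 1 ∣ val p h := dvd_val_of_Lam hp hf i (by rw [h2])
    have h4 := dvd_Lam_of_val hp 0 h3
    rw [hL0] at h4
    have h5 := Nat.eq_zero_of_dvd_of_lt h4 hn0lt
    have h6 : h = 0 := by
      by_contra hne
      have := Lam_pos hp f 0 hne
      omega
    rw [h6] at h2
    simp at h2
    omega
  obtain ⟨R, hR⟩ := Multiset.le_iff_exists_add.1 hb
  obtain ⟨S, R', Y, e, hS, hY⟩ := pack_comp hp hf h R n (by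
    intro i
    have h1 := dvd_Lam_of_val hp i hdvd
    rw [Lam_add] at h1
    have h2 := Nat.le_of_dvd (by have := Lam_pos hp f i hb0; omega) h1
    have h3 := hLh i
    have h4 := hno i (Lam p f i b + Lam p f i h - (p ^ f - 1)) (Nat.dvd_sub h1 dvd_rfl) (by omega)
    rw [hR, Lam_add, add_mul] at h4
    omega)
  have hc := hY.cons (a := b + S) (fun h0 => hb0 (add_eq_zero.1 h0).1) (by
    rw [val_add]
    have h1 := (hS.val_modEq hp).add_left (val p b)
    rw [Multiset.map_id, ← val_add p b h] at h1
    exact (Nat.modEq_zero_iff_dvd.1 (h1.trans (Nat.modEq_zero_iff_dvd.2 hdvd))))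
  have e2 : b + S + R' = K := by rw [hR, e, add_assoc]
  rw [e2] at hc
  have := hmax _ hc
  simp [consF] at this
  omega

lemma IsComp.Lam_split {n : ℕ} {K : Multiset ℕ} {Y : ℕ → Multiset ℕ} (h : IsComp p f (n + 1) K Y) (i : ℕ) :
    Lam p f i K = Lam p f i (Y 0) + ∑ m ∈ Finset.range n, Lam p f i (Y (m + 1)) + Lam p f i (Y (n + 1)) := by
  rw [← h.tot, Lam_sum, Finset.sum_range_succ, Finset.sum_range_succ']
  ring

lemma IsComp.mid_ge (hp : 2 ≤ p) {n : ℕ} {K : Multiset ℕ} {Y : ℕ → Multiset ℕ} (h : IsComp p f (n + 1) K Y) (i : ℕ) :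
    n * (p ^ f - 1) ≤ ∑ m ∈ Finset.range n, Lam p f i (Y (m + 1)) := by
  have : ∑ m ∈ Finset.range n, (p ^ f - 1) ≤ ∑ m ∈ Finset.range n, Lam p f i (Y (m + 1)) := by
    apply Finset.sum_le_sum
    intro m hm
    simp at hm
    exact q1_le_Lam hp i (h.ne _ (by omega)) (h.dvd _ (by omega))
  simpa using this

lemma IsComp.mid_eq (hp : 2 ≤ p) {n : ℕ} {K : Multiset ℕ} {Y : ℕ → Multiset ℕ} (h : IsComp p f (n + 1) K Y) {i : ℕ}
    (hlt : Lam p f i K < Lam p f i (Y 0) + (n + 1) * (p ^ f - 1)) :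
    (∀ m, 1 ≤ m → m < n + 1 → Lam p f i (Y m) = p ^ f - 1) ∧
      Lam p f i K = Lam p f i (Y 0) + n * (p ^ f - 1) + Lam p f i (Y (n + 1)) := by
  have hs := h.Lam_split i
  have hge : ∀ m < n, p ^ f - 1 ≤ Lam p f i (Y (m + 1)) := fun m hm =>
    q1_le_Lam hp i (h.ne _ (by omega)) (h.dvd _ (by omega))
  have hsum : ∑ m ∈ Finset.range n, Lam p f i (Y (m + 1)) =
      n * (p ^ f - 1) + ∑ m ∈ Finset.range n, (Lam p f i (Y (m + 1)) - (p ^ f - 1)) := by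
    have : n * (p ^ f - 1) = ∑ m ∈ Finset.range n, (p ^ f - 1) := by simp
    rw [this, ← Finset.sum_add_distrib]
    apply Finset.sum_congr rfl
    intro m hm
    have := hge m (by simpa using hm)
    omega
  have key : ∀ m, 1 ≤ m → m < n + 1 → Lam p f i (Y m) = p ^ f - 1 := by
    intro m hm hmn
    obtain ⟨m, rfl⟩ : ∃ m', m = m' + 1 := ⟨m - 1, by omega⟩
    by_contra hne
    have h1 := hge m (by omega)
    have h2 : p ^ f - 1 + (p ^ f - 1) ≤ Lam p f i (Y (m + 1)) := by
      refine modEq_lt ?_ (by omega)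
      have := dvd_Lam_of_val hp i (h.dvd (m + 1) hmn)
      exact (Nat.modEq_zero_iff_dvd.2 this).trans (by simp [Nat.ModEq])
    have h3 := Finset.single_le_sum (f := fun m => Lam p f i (Y (m + 1)) - (p ^ f - 1)) (s := Finset.range n)
      (fun _ _ => Nat.zero_le _) (by simp; omega : m ∈ Finset.range n)
    rw [add_mul] at hlt
    omega
  refine ⟨key, ?_⟩
  rw [hs]
  congr 2
  have : ∑ m ∈ Finset.range n, Lam p f i (Y (m + 1)) = ∑ m ∈ Finset.range n, (p ^ f - 1) := by
    apply Finset.sum_congr rfl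
    intro m hm
    simp at hm
    exact key _ (by omega) (by omega)
  rw [this]; simp

lemma IsComp.le {n : ℕ} {K : Multiset ℕ} {Y : ℕ → Multiset ℕ} (h : IsComp p f n K Y) {m : ℕ} (hm : m ≤ n) : Y m ≤ K := by
  rw [← h.tot]
  exact Finset.single_le_sum (f := Y) (fun _ _ => Multiset.zero_le _) (by simp; omega)

lemma IsComp.le2 {n : ℕ} {K : Multiset ℕ} {Y : ℕ → Multiset ℕ} (h : IsComp p f n K Y) {m : ℕ} (h1 : 1 ≤ m) (hm : m ≤ n) :
    Y 0 + Y m ≤ K := by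
  rw [← h.tot, sum_two n m h1 hm]
  exact Multiset.le_add_right _ _

/-- Output of the rejection argument for an item `y` above `e` outside the first bin. -/
lemma reject2 (hp : 2 ≤ p) (hf : 0 < f) {n : ℕ} {K : Multiset ℕ} {M Z : ℕ → Multiset ℕ} (hK : ∀ t, K.count t ≤ p - 1)
    (hM : IsComp p f (n + 1) K M) (hZ : IsComp p f (n + 1) K Z)
    (hmax : ∀ Y, IsComp p f (n + 1) K Y → val p (Y 0) ≤ val p (M 0)) {e : ℕ}
    (hlt : (Z 0).count e < (M 0).count e) (hgt : ∀ t, e < t → (Z 0).count t = (M 0).count t)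
    {y m : ℕ} (hy : e < y) (hm : 1 ≤ m) (hmn : m ≤ n + 1) (hym : y ∈ Z m) :
    ∃ i, Lam p f i ((Z 0).filter (fun t => e ≤ t)) + lam p f i e ≤ Lam p f i (Z 0) ∧
      Lam p f i (Z 0) < Lam p f i ((Z 0).filter (fun t => e ≤ t)) + lam p f i y ∧
      (∀ m, 1 ≤ m → m < n + 1 → Lam p f i (Z m) = p ^ f - 1) ∧ Lam p f i (M (n + 1)) = Lam p f i (Z (n + 1)) := by
  set a0 := (Z 0).filter (fun t => e ≤ t) with ha0
  have hfe : (M 0).filter (fun t => y ≤ t) = (Z 0).filter (fun t => y ≤ t) := by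
    ext t
    simp only [Multiset.count_filter]
    split_ifs with h
    · exact (hgt t (by omega)).symm
    · rfl
  set b := (Z 0).filter (fun t => y ≤ t) + {y} with hb
  have hbK : b ≤ K := by
    refine le_trans ?_ (hZ.le2 hm hmn)
    exact add_le_add (Multiset.filter_le _ _) (by simpa using hym)
  have hMc : ∀ t, (M 0).count t ≤ p - 1 := fun t => (Multiset.count_le_of_le t (hM.le (Nat.zero_le _))).trans (hK t)
  have hvb : val p (M 0) < val p b := by
    apply lt_of_top hp hMc (e := y)
    · rw [hb, ← hfe, Multiset.count_add, Multiset.count_filter]; simp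
    · intro t ht
      rw [hb, ← hfe, Multiset.count_add, Multiset.count_filter, if_pos ht.le]
      simp [ht.ne']
  obtain ⟨i, κ, hκd, hκ, hKl⟩ := reject hp hf hmax hbK hvb
  have hbL : Lam p f i b ≤ Lam p f i a0 + lam p f i y := by
    rw [hb, Lam_add, Lam_singleton]
    apply Nat.add_le_add_right
    apply Lam_le
    apply Multiset.monotone_filter_right
    intro t ht
    omega
  have haM : a0 + {e} ≤ M 0 := by
    rw [Multiset.le_iff_count]
    intro t
    rw [Multiset.count_add, ha0, Multiset.count_filter, Multiset.count_singleton]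
    rcases lt_trichotomy t e with h | h | h
    · rw [if_neg (by omega : ¬ e ≤ t)]; simp [h.ne]
    · subst h; simp; omega
    · simp [h.le, h.ne', hgt t h]
  have haML := Lam_le p f i haM
  rw [Lam_add, Lam_singleton] at haML
  have haZL : Lam p f i a0 ≤ Lam p f i (Z 0) := Lam_le p f i (Multiset.filter_le _ _)
  have hly := lam_le_q1 hp hf i y
  have hle := lam_pos hp f i e
  have upper : ∀ Y, IsComp p f (n + 1) K Y → Lam p f i (Y 0) ≤ κ := by
    intro Y hY
    by_contra hgt
    push Not at hgt
    have h1 : κ + (p ^ f - 1) ≤ Lam p f i (Y 0) := by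
      refine modEq_lt ?_ hgt
      exact (Nat.modEq_zero_iff_dvd.2 (dvd_Lam_of_val hp i (hY.dvd 0 (by omega)))).trans (Nat.modEq_zero_iff_dvd.2 hκd).symm
    have h2 := hY.Lam_split i
    have h3 := hY.mid_ge hp i
    rw [add_mul] at hKl
    omega
  have lower : ∀ Y, IsComp p f (n + 1) K Y → Lam p f i a0 ≤ Lam p f i (Y 0) → Lam p f i (Y 0) = κ := by
    intro Y hY ha
    by_contra hne
    have h0 := upper Y hY
    have h1 : Lam p f i (Y 0) + (p ^ f - 1) ≤ κ := by
      refine modEq_lt ?_ (by omega)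
      exact (Nat.modEq_zero_iff_dvd.2 hκd).trans (Nat.modEq_zero_iff_dvd.2 (dvd_Lam_of_val hp i (hY.dvd 0 (by omega)))).symm
    omega
  have hZ0 := lower Z hZ haZL
  have hM0 := lower M hM (by omega)
  obtain ⟨hz1, hz2⟩ := hZ.mid_eq hp (i := i) (by omega)
  obtain ⟨hm1, hm2⟩ := hM.mid_eq hp (i := i) (by omega)
  exact ⟨i, by omega, by omega, hz1, by omega⟩

/-- position bookkeeping -/
lemma pos_shift (hf : 0 < f) {c i x : ℕ} (h : (c + i) % f + x < f) : (c + x + i) % f = (c + i) % f + x := by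
  have : c + x + i = (c + i) + x := by ring
  rw [this, ← Nat.mod_add_mod, Nat.mod_eq_of_lt h]

lemma class_of_pos {c i y : ℕ} (h : (c + i) % f ≤ (y + i) % f) :
    y % f = (c + ((y + i) % f - (c + i) % f)) % f := by
  have h1 : y + i ≡ (c + ((y + i) % f - (c + i) % f)) + i [MOD f] := by
    have h2 : (c + ((y + i) % f - (c + i) % f)) + i = (c + i) + ((y + i) % f - (c + i) % f) := by ring
    rw [h2]
    unfold Nat.ModEq
    rw [← Nat.mod_add_mod (c + i), Nat.add_sub_of_le h, Nat.mod_mod]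
  exact Nat.ModEq.add_right_cancel' i h1

lemma choose_cut (hp : 2 ≤ p) (hf : 0 < f) {n : ℕ} {K : Multiset ℕ} {M Z : ℕ → Multiset ℕ} (hK : ∀ t, K.count t ≤ p - 1)
    (hM : IsComp p f (n + 1) K M) (hZ : IsComp p f (n + 1) K Z)
    (hmax : ∀ Y, IsComp p f (n + 1) K Y → val p (Y 0) ≤ val p (M 0)) {c : ℕ}
    (hlt : (Z 0).count c < (M 0).count c) (hgt : ∀ t, c < t → (Z 0).count t = (M 0).count t)
    {g0 : Multiset ℕ} (hg0 : Dig p f g0)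
    (hgV : val p g0 ≡ val p ((Z 0).filter (fun t => t < c)) [MOD p ^ f - 1]) (hg0ne : g0 ≠ 0)
    {r : ℕ} (hr : r < f) (hmin : ∀ u ∈ g0, ∀ x, u % f = (c + x) % f → r ≤ x) :
    ∃ i, (c + i) % f + r < f ∧ (∀ m, 1 ≤ m → m ≤ n + 1 → ∀ y ∈ Z m, c < y → (c + i) % f + r < (y + i) % f) ∧
      (∀ m, 1 ≤ m → m < n + 1 → Lam p f i ((Z m).filter (fun t => c < t)) ≤ p ^ f - 1) ∧
      Lam p f i ((Z (n + 1)).filter (fun t => c < t)) ≤ Lam p f i (M (n + 1)) := by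
  by_cases hP : ∃ y m, 1 ≤ m ∧ m ≤ n + 1 ∧ y ∈ Z m ∧ c < y
  · let Rej : ℕ → ℕ → Prop := fun i y => (c + i) % f + r < (y + i) % f ∧
      (∀ m, 1 ≤ m → m < n + 1 → Lam p f i (Z m) = p ^ f - 1) ∧ Lam p f i (M (n + 1)) = Lam p f i (Z (n + 1))
    have hrej : ∀ y m, 1 ≤ m → m ≤ n + 1 → y ∈ Z m → c < y → ∃ i, Rej i y := by
      intro y m h1 h2 h3 h4
      obtain ⟨i, e1, e2, e3, e4⟩ := reject2 hp hf hK hM hZ hmax hlt hgt h4 h1 h2 h3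
      refine ⟨i, ?_, e3, e4⟩
      set V0 := (Z 0).filter (fun t => t < c) with hV0
      have hsplit : Z 0 = (Z 0).filter (fun t => c ≤ t) + V0 := by
        rw [hV0]
        conv_lhs => rw [← Multiset.filter_add_not (fun t => c ≤ t) (Z 0)]
        simp
      have hLs : Lam p f i (Z 0) = Lam p f i ((Z 0).filter (fun t => c ≤ t)) + Lam p f i V0 := by
        conv_lhs => rw [hsplit]
        rw [Lam_add]
      have hlc := lam_pos hp f i c
      have hly := lam_le_q1 hp hf i y
      have hgL : Lam p f i g0 = Lam p f i V0 := by
        have hc := Lam_modEq_of_val hp i hgV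
        apply le_antisymm
        · exact modEq_le hc.symm (by omega) (Dig_Lam_le hp hf hg0 i)
        · exact modEq_le hc (Lam_pos hp f i hg0ne) (by omega)
      have hu : ∃ u ∈ g0, (c + i) % f ≤ (u + i) % f := by
        by_contra hno
        push Not at hno
        have := Dig_Lam_lt hp hf hg0 i ((c + i) % f) (Nat.mod_lt _ hf).le hno
        change _ < lam p f i c at this
        omega
      obtain ⟨u, hu, huc⟩ := hu
      have huy : (u + i) % f < (y + i) % f := by
        have h5 : lam p f i u ≤ Lam p f i g0 := by
          have := Lam_le p f i (Multiset.singleton_le.2 hu)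
          simpa using this
        have h6 : lam p f i u < lam p f i y := by omega
        unfold lam at h6
        exact (Nat.pow_lt_pow_iff_right (by omega)).1 h6
      have := hmin u hu _ (class_of_pos huc)
      omega
    have hex : ∃ π, ∃ i y m, 1 ≤ m ∧ m ≤ n + 1 ∧ y ∈ Z m ∧ c < y ∧ Rej i y ∧ (c + i) % f = π := by
      obtain ⟨y, m, h1, h2, h3, h4⟩ := hP
      obtain ⟨i, hi⟩ := hrej y m h1 h2 h3 h4
      exact ⟨_, i, y, m, h1, h2, h3, h4, hi, rfl⟩
    classical
    obtain ⟨i, y, m, h1, h2, h3, h4, hi, hπ⟩ := Nat.find_spec hex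
    have hmn : ∀ y m, 1 ≤ m → m ≤ n + 1 → y ∈ Z m → c < y → ∀ i', Rej i' y → (c + i) % f ≤ (c + i') % f := by
      intro y m h1 h2 h3 h4 i' hi'
      rw [hπ]
      exact Nat.find_min' hex ⟨i', y, m, h1, h2, h3, h4, hi', rfl⟩
    refine ⟨i, ?_, ?_, ?_, ?_⟩
    · exact hi.1.trans (Nat.mod_lt _ hf)
    · intro m h1 h2 y h3 h4
      obtain ⟨i', hi'⟩ := hrej y m h1 h2 h3 h4
      have hle := hmn y m h1 h2 h3 h4 i' hi'
      have hi1 := hi'.1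
      have hcl := class_of_pos (f := f) (c := c) (i := i') (y := y) (by omega)
      have hy := Nat.mod_lt (y + i') hf
      set η := (y + i') % f - (c + i') % f
      have h5 : (y + i) % f = (c + i) % f + η := by
        rw [← pos_shift hf (by omega), Nat.add_mod, hcl, ← Nat.add_mod]
      omega
    · intro m h1 h2
      rw [← hi.2.1 m h1 h2]
      exact Lam_le p f i (Multiset.filter_le _ _)
    · rw [hi.2.2]
      exact Lam_le p f i (Multiset.filter_le _ _)
  · push Not at hP
    have hz : ∀ m, 1 ≤ m → m ≤ n + 1 → (Z m).filter (fun t => c < t) = 0 := by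
      intro m h1 h2
      rw [Multiset.filter_eq_nil]
      intro y hy
      have := hP y m h1 h2 hy
      omega
    have h0 : (c + c * (f - 1)) % f = 0 := by
      have : c + c * (f - 1) = f * c := by
        obtain ⟨g, rfl⟩ : ∃ g, f = g + 1 := ⟨f - 1, by omega⟩
        simp; ring
      rw [this]; simp
    refine ⟨c * (f - 1), by omega, ?_, ?_, ?_⟩
    · intro m h1 h2 y h3 h4
      have := hP y m h1 h2 h3
      omega
    · intro m h1 h2
      rw [hz m h1 h2.le]; simp
    · rw [hz _ (by omega) le_rfl]; simp

end Sheats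



namespace Sheats

variable {p f : ℕ}

lemma top_le {Z0 M0 : Multiset ℕ} {e : ℕ} (hlt : Z0.count e < M0.count e) (hgt : ∀ t, e < t → Z0.count t = M0.count t) :
    Z0.filter (fun t => e ≤ t) + {e} ≤ M0 := by
  rw [Multiset.le_iff_count]
  intro t
  rw [Multiset.count_add, Multiset.count_filter, Multiset.count_singleton]
  rcases lt_trichotomy t e with h | h | h
  · rw [if_neg (by omega : ¬ e ≤ t)]; simp [h.ne]
  · subst h; simp; omega
  · simp [h.le, h.ne', hgt t h]

lemma filter_split (B : Multiset ℕ) (c : ℕ) : B = B.filter (fun t => c ≤ t) + B.filter (fun t => t < c) := by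
  conv_lhs => rw [← Multiset.filter_add_not (fun t => c ≤ t) B]
  simp

/-- there is a copy of `c` outside bin zero -/
lemma exists_J {n : ℕ} {K : Multiset ℕ} {M Z : ℕ → Multiset ℕ}
    (hM : IsComp p f (n + 1) K M) (hZ : IsComp p f (n + 1) K Z) {c : ℕ}
    (hlt : (Z 0).count c < (M 0).count c) : ∃ J, 1 ≤ J ∧ J ≤ n + 1 ∧ c ∈ Z J := by
  by_contra hno
  push Not at hno
  have h1 := Multiset.count_le_of_le c (hM.le (Nat.zero_le _))
  rw [← hZ.tot, Finset.sum_range_succ', Multiset.count_add, Multiset.count_sum'] at h1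
  have : ∑ m ∈ Finset.range (n + 1), (Z (m + 1)).count c = 0 := by
    apply Finset.sum_eq_zero
    intro m hm
    simp at hm
    exact Multiset.count_eq_zero.2 (hno _ (by omega) (by omega))
  omega

lemma exchange_empty (hp : 2 ≤ p) (hf : 0 < f) {n : ℕ} {K : Multiset ℕ} {M Z : ℕ → Multiset ℕ} (hK : ∀ t, K.count t ≤ p - 1)
    (hM : IsComp p f (n + 1) K M) (hZ : IsComp p f (n + 1) K Z)
    (hmax : ∀ Y, IsComp p f (n + 1) K Y → val p (Y 0) ≤ val p (M 0)) {c : ℕ}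
    (hlt : (Z 0).count c < (M 0).count c) (hgt : ∀ t, c < t → (Z 0).count t = (M 0).count t)
    (hV : (Z 0).filter (fun t => t < c) = 0) : ∃ Y, IsComp p f (n + 1) K Y ∧ wt p (n + 1) Y < wt p (n + 1) Z := by
  have hq := q1_pos hp hf
  have hZa : (Z 0).filter (fun t => c ≤ t) = Z 0 := by
    conv_rhs => rw [filter_split (Z 0) c, hV, add_zero]
  obtain ⟨J, hJ1, hJ2, hJ⟩ := exists_J hM hZ hlt
  set T := ∑ m ∈ Finset.range (n + 1), Z (m + 1) with hT
  have hKT : K = Z 0 + T := by rw [← hZ.tot, Finset.sum_range_succ', add_comm]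
  have hTc : ∀ t, T.count t ≤ p - 1 := fun t =>
    (Multiset.count_le_of_le t (by rw [hKT]; exact Multiset.le_add_left _ _)).trans (hK t)
  have hTlt : ∀ t ∈ T, t < c + 1 := by
    intro y hy
    by_contra hyc
    obtain ⟨m, hm, hym⟩ := Multiset.mem_sum.1 hy
    simp at hm
    obtain ⟨i, h1, -⟩ := reject2 hp hf hK hM hZ hmax hlt hgt (y := y) (m := m + 1) (by omega) (by omega) (by omega) hym
    rw [hZa] at h1
    have := lam_pos hp f i c
    omega
  have hTL : ∀ s, (n + 1) * (p ^ f - 1) ≤ Lam p f s T := by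
    intro s
    have h1 := Lam_le p f s (top_le hlt hgt)
    rw [hZa, Lam_add, Lam_singleton] at h1
    have h0 := lam_pos hp f s c
    have h2 : Lam p f s (Z 0) + (p ^ f - 1) ≤ Lam p f s (M 0) := by
      refine modEq_lt ?_ (by omega)
      exact (Nat.modEq_zero_iff_dvd.2 (dvd_Lam_of_val hp s (hM.dvd 0 (by omega)))).trans
        (Nat.modEq_zero_iff_dvd.2 (dvd_Lam_of_val hp s (hZ.dvd 0 (by omega)))).symm
    have h3 := hM.Lam_split s
    have h4 := hM.mid_ge hp s
    rw [hKT, Lam_add] at h3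
    rw [add_mul]
    omega
  obtain ⟨Y0, T1, e, hw, hY0, hdvd, hT1⟩ := window_step hp hf hTc hTlt hTL
  have hT1c : ∀ t, T1.count t ≤ p - 1 := fun t =>
    (Multiset.count_le_of_le t (by rw [e]; exact Multiset.le_add_left _ _)).trans (hTc t)
  obtain ⟨Y, hY, hYw⟩ := window hp hf n (c + 1 - f) T1 hT1c (by
    intro t ht
    by_contra hge
    have h1 := Multiset.count_le_of_le t hw
    rw [Multiset.count_filter, if_pos (by omega), e, Multiset.count_add] at h1
    have := Multiset.count_pos.2 ht
    omega) hT1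
  have hc := hY.cons (a := Z 0 + Y0) (fun h0 => hY0 (add_eq_zero.1 h0).2) (by
    rw [val_add]; exact dvd_add (hZ.dvd 0 (by omega)) hdvd)
  have e2 : Z 0 + Y0 + T1 = K := by rw [hKT, e, add_assoc]
  rw [e2] at hc
  refine ⟨_, hc, ?_⟩
  rw [wt_cons hY, wt_shift, ← hT, e, val_add]
  have hcY : c ∈ Y0 := by
    apply Multiset.mem_of_le hw
    rw [Multiset.mem_filter]
    refine ⟨?_, by omega⟩
    rw [hT, Multiset.mem_sum]
    exact ⟨J - 1, by simp; omega, by rwa [Nat.sub_add_cancel hJ1]⟩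
  have h1 : p ^ c ≤ val p Y0 := by
    have := val_le p (Multiset.singleton_le.2 hcY)
    simpa using this
  have h2 : p ^ (c + 1 - f) ≤ p ^ c := Nat.pow_le_pow_right (by omega) (by omega)
  have h3 : wt p n Y ≤ (p ^ f - 1) * wt p n Y := Nat.le_mul_of_pos_left _ hq
  omega

end Sheats



namespace Sheats

variable {p f : ℕ}

lemma exists_rep (hp : 2 ≤ p) (hf : 0 < f) {V : Multiset ℕ} (hV : V ≠ 0) :
    ∃ g, Dig p f g ∧ g ≠ 0 ∧ val p g ≡ val p V [MOD p ^ f - 1] := by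
  have hq := q1_pos hp hf
  have hq1 := q1_add (f := f) hp
  have hL := Lam_pos hp f 0 hV
  set n := (Lam p f 0 V - 1) % (p ^ f - 1) + 1 with hn
  have hlt : (Lam p f 0 V - 1) % (p ^ f - 1) < p ^ f - 1 := Nat.mod_lt _ hq
  have hLd : Lam p f 0 (digs p f 0 n) = n := Lam_digs hf (by omega)
  refine ⟨digs p f 0 n, Dig_digs hp 0 n, ?_, ?_⟩
  · intro h
    rw [h] at hLd
    simp at hLd
  · apply val_modEq_of_Lam hp hf 0
    rw [hLd, hn]
    have : (Lam p f 0 V - 1) % (p ^ f - 1) + 1 ≡ (Lam p f 0 V - 1) + 1 [MOD p ^ f - 1] :=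
      (Nat.mod_modEq _ _).add_right 1
    rwa [Nat.sub_add_cancel hL] at this

lemma exists_r (hf : 0 < f) {g : Multiset ℕ} (hg : g ≠ 0) (c : ℕ) :
    ∃ r < f, (∃ u ∈ g, u % f = (c + r) % f) ∧ ∀ u ∈ g, ∀ x, u % f = (c + x) % f → r ≤ x := by
  obtain ⟨u, hu⟩ := Multiset.exists_mem_of_ne_zero hg
  have hcl : u % f = (c + (u + c * (f - 1)) % f) % f := by
    rw [Nat.add_mod_mod]
    have : c + (u + c * (f - 1)) = u + f * c := by
      obtain ⟨g, rfl⟩ : ∃ g, f = g + 1 := ⟨f - 1, by omega⟩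
      simp; ring
    rw [this, Nat.add_mul_mod_self_left]
  have hex : ∃ x, ∃ u ∈ g, u % f = (c + x) % f := ⟨_, u, hu, hcl⟩
  classical
  refine ⟨Nat.find hex, ?_, Nat.find_spec hex, ?_⟩
  · exact (Nat.find_min' hex ⟨u, hu, hcl⟩).trans_lt (Nat.mod_lt _ hf)
  · intro u hu x hx
    exact Nat.find_min' hex ⟨u, hu, hx⟩

lemma dvd_Lam_of_pos {i k : ℕ} {a : Multiset ℕ} (h : ∀ y ∈ a, k ≤ (y + i) % f) : p ^ k ∣ Lam p f i a := by
  apply Multiset.dvd_sum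
  intro x hx
  obtain ⟨y, hy, rfl⟩ := Multiset.mem_map.1 hx
  exact pow_dvd_pow p (h y hy)

lemma add_le_of_dvd (hp : 2 ≤ p) {A k : ℕ} (hk : k ≤ f) (hd : p ^ k ∣ A) (hA : A ≤ p ^ f - 1) : A + p ^ k ≤ p ^ f := by
  have hq1 := q1_add (f := f) hp
  have h1 : p ^ k ∣ p ^ f - A := Nat.dvd_sub (pow_dvd_pow p hk) hd
  have := Nat.le_of_dvd (by omega) h1
  omega

lemma pos_sub {i t k y : ℕ} (h : i % f = (t + k) % f) (hk : k ≤ (y + i) % f) (hf : 0 < f) : (y + t) % f = (y + i) % f - k := by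
  have h1 : (y + t) + k ≡ ((y + i) % f - k) + k [MOD f] := by
    rw [Nat.sub_add_cancel hk]
    have : (y + t) + k = y + (t + k) := by ring
    rw [this]
    exact (Nat.ModEq.add_left y (show t + k ≡ i [MOD f] from h.symm)).trans (Nat.mod_modEq _ _).symm
  have h2 := Nat.ModEq.add_right_cancel' k h1
  have h3 := Nat.mod_lt (y + i) hf
  unfold Nat.ModEq at h2
  rw [h2, Nat.mod_eq_of_lt (by omega)]

lemma Lam_shift {i t k : ℕ} (hf : 0 < f) (h : i % f = (t + k) % f) {a : Multiset ℕ} (ha : ∀ y ∈ a, k ≤ (y + i) % f) :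
    Lam p f i a = p ^ k * Lam p f t a := by
  unfold Lam
  rw [← Multiset.sum_map_mul_left]
  congr 1
  apply Multiset.map_congr rfl
  intro y hy
  unfold lam
  rw [pos_sub h (ha y hy) hf, ← pow_add, Nat.add_sub_of_le (ha y hy)]

/-- covering by the movable part of a middle bin -/
lemma cover_U (hp : 2 ≤ p) (hf : 0 < f) {c i r x : ℕ} {B a U : Multiset ℕ} (hr : (c + i) % f + r < f)
    (hB : B = a + x • {c} + U) (hne : B ≠ 0) (hdvd : p ^ f - 1 ∣ val p B) (hx : x ≤ p - 2)
    (ha : ∀ y ∈ a, (c + i) % f + r < (y + i) % f) (hA : Lam p f i a ≤ p ^ f - 1) :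
    U ≠ 0 ∧ ∀ j, Lam p f j (seg c (r + 1)) ≤ Lam p f j U := by
  have hq1 := q1_add (f := f) hp
  set π := (c + i) % f with hπ
  have hd1 : p ^ (π + r + 1) ∣ Lam p f i a := dvd_Lam_of_pos (fun y hy => ha y hy)
  have hd2 : p ^ (π + 1) ∣ Lam p f i a := (pow_dvd_pow p (by omega)).trans hd1
  have h1 := add_le_of_dvd hp (by omega) hd2 hA
  have h2 : x * p ^ π + 2 * p ^ π ≤ p ^ (π + 1) := by
    rw [← add_mul, pow_succ, mul_comm]
    exact Nat.mul_le_mul_left _ (by omega)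
  have hpos : 0 < p ^ π := by positivity
  have hLB : Lam p f i B = Lam p f i a + x * p ^ π + Lam p f i U := by
    rw [hB, Lam_add, Lam_add, Lam_nsmul, Lam_singleton]; rfl
  have hge := q1_le_Lam hp i hne hdvd
  have hU : U ≠ 0 := by
    rintro rfl
    simp at hLB
    omega
  refine ⟨hU, ?_⟩
  intro j
  set n := p ^ f - 1 - Lam p f i a - x * p ^ π with hn
  have hc := cover hp hf (n := n) (x := x) hr (by omega) hx (by
    have : n + 1 + x * p ^ π = p ^ f - Lam p f i a := by omega
    rw [← hπ, this]
    exact Nat.dvd_sub (pow_dvd_pow p (by omega)) hd1) j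
  refine hc.trans (Lam_of_dig hp hf hU (Dig_digs hp i n) ?_ j)
  apply val_modEq_of_Lam hp hf i
  rw [Lam_digs hf (by omega)]
  have h3 : (Lam p f i a + x * p ^ π) + Lam p f i U ≡ (Lam p f i a + x * p ^ π) + n [MOD p ^ f - 1] := by
    rw [← hLB]
    have : Lam p f i a + x * p ^ π + n = p ^ f - 1 := by omega
    rw [this]
    exact (Nat.modEq_zero_iff_dvd.2 (dvd_Lam_of_val hp i hdvd)).trans (by simp [Nat.ModEq])
  exact Nat.ModEq.add_left_cancel' _ h3

/-- the target of a middle bin -/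
lemma target_mid (hp : 2 ≤ p) (hf : 0 < f) {c i r : ℕ} {a : Multiset ℕ} (hr : (c + i) % f + r < f)
    (ha : ∀ y ∈ a, (c + i) % f + r < (y + i) % f) (hA : Lam p f i a ≤ p ^ f - 1) :
    p ^ f - 1 ∣ val p (a + digs p f i (p ^ f - 1 - Lam p f i a)) ∧
    (∀ j, Lam p f j (seg c (r + 1)) ≤ Lam p f j (digs p f i (p ^ f - 1 - Lam p f i a))) ∧
    (∀ ρ < r, ∀ t, (c + ρ + t) % f = f - 1 → Lam p f t a + Lam p f t (digs p f i (p ^ f - 1 - Lam p f i a)) ≤ p ^ f - 1) := by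
  have hq1 := q1_add (f := f) hp
  have hd1 : p ^ ((c + i) % f + r + 1) ∣ Lam p f i a := dvd_Lam_of_pos (fun y hy => ha y hy)
  have h1 := add_le_of_dvd hp (by omega) hd1 hA
  have hpos : p ≤ p ^ ((c + i) % f + r + 1) := Nat.le_self_pow (by omega) p
  have hL : Lam p f i (digs p f i (p ^ f - 1 - Lam p f i a)) = p ^ f - 1 - Lam p f i a := Lam_digs hf (by omega)
  have hdvd : p ^ f - 1 ∣ val p (a + digs p f i (p ^ f - 1 - Lam p f i a)) := by
    apply dvd_val_of_Lam hp hf i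
    rw [Lam_add, hL, Nat.add_sub_of_le hA]
  refine ⟨hdvd, ?_, ?_⟩
  · apply cover hp hf (x := 0) hr (by omega) (by omega)
    have : p ^ f - 1 - Lam p f i a + 1 + 0 * p ^ ((c + i) % f) = p ^ f - Lam p f i a := by omega
    rw [this]
    exact Nat.dvd_sub (pow_dvd_pow p (by omega)) hd1
  · intro ρ hρ t ht
    have hk : i % f = (t + ((c + i) % f + ρ + 1)) % f := by
      have e1 : i + (c + ρ + t + 1) ≡ (t + ((c + i) % f + ρ + 1)) [MOD f] := by
        have : i + (c + ρ + t + 1) = t + ((c + i) + ρ + 1) := by ring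
        rw [this]
        exact ((((Nat.mod_modEq _ _).symm).add_right ρ).add_right 1).add_left t
      have e2 : i + (c + ρ + t + 1) ≡ i [MOD f] := by
        have : c + ρ + t + 1 ≡ 0 [MOD f] := by
          have e3 : (c + ρ + t) + 1 ≡ (f - 1) + 1 [MOD f] := by
            apply Nat.ModEq.add_right
            rw [← ht]
            exact (Nat.mod_modEq _ _).symm
          rw [Nat.sub_add_cancel hf] at e3
          exact e3.trans (by simp [Nat.ModEq])
        simpa using this.add_left i
      exact e2.symm.trans e1
    have h2 := Lam_shift (p := p) hf hk (a := a) (fun y hy => by have := ha y hy; omega)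
    have h3 : Lam p f t a ≤ Lam p f i a := by
      rw [h2]
      exact Nat.le_mul_of_pos_left _ (by positivity)
    have h4 := Dig_Lam_le hp hf (Dig_digs (f := f) hp i (p ^ f - 1 - Lam p f i a)) t
    by_contra hgt
    push Not at hgt
    have h5 := dvd_Lam_of_val hp t hdvd
    rw [Lam_add] at h5
    have h6 : (p ^ f - 1) + (p ^ f - 1) ≤ Lam p f t a + Lam p f t (digs p f i (p ^ f - 1 - Lam p f i a)) := by
      refine modEq_lt ?_ hgt
      exact (Nat.modEq_zero_iff_dvd.2 h5).trans (by simp [Nat.ModEq])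
    omega

lemma cut_rel {c i ρ t : ℕ} (hf : 0 < f) (ht : (c + ρ + t) % f = f - 1) : i % f = (t + ((c + i) % f + ρ + 1)) % f := by
  have e1 : i + (c + ρ + t + 1) ≡ (t + ((c + i) % f + ρ + 1)) [MOD f] := by
    have : i + (c + ρ + t + 1) = t + ((c + i) + ρ + 1) := by ring
    rw [this]
    exact ((((Nat.mod_modEq _ _).symm).add_right ρ).add_right 1).add_left t
  have e2 : i + (c + ρ + t + 1) ≡ i [MOD f] := by
    have : c + ρ + t + 1 ≡ 0 [MOD f] := by
      have e3 : (c + ρ + t) + 1 ≡ (f - 1) + 1 [MOD f] := by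
        apply Nat.ModEq.add_right
        rw [← ht]
        exact (Nat.mod_modEq _ _).symm
      rw [Nat.sub_add_cancel hf] at e3
      exact e3.trans (by simp [Nat.ModEq])
    simpa using this.add_left i
  exact e2.symm.trans e1

/-- last bin -/
lemma last_le (hp : 2 ≤ p) (hf : 0 < f) {c i r : ℕ} {a b : Multiset ℕ}
    (ha : ∀ y ∈ a, (c + i) % f + r < (y + i) % f) (hA : Lam p f i a ≤ Lam p f i b)
    {ρ t : ℕ} (hρ : ρ < r) (ht : (c + ρ + t) % f = f - 1) : Lam p f t a ≤ Lam p f t b := by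
  have hk := cut_rel (i := i) hf ht
  have h2 := Lam_shift (p := p) hf hk (a := a) (fun y hy => by have := ha y hy; omega)
  have h3 := Lam_succ_le hp hf t ((c + i) % f + ρ + 1) b
  rw [← Lam_congr p _ hk] at h3
  rw [h2] at hA
  exact Nat.le_of_mul_le_mul_left (hA.trans h3) (by positivity)

/-- first bin -/
lemma first_le (hp : 2 ≤ p) (hf : 0 < f) {c r : ℕ} {a g M0 : Multiset ℕ} (hM : a + {c} ≤ M0) (hd : p ^ f - 1 ∣ val p M0)
    (hd' : p ^ f - 1 ∣ val p (a + g)) (hg : Dig p f g) (hr : r < f) (hmin : ∀ u ∈ g, ∀ x, u % f = (c + x) % f → r ≤ x)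
    {ρ t : ℕ} (hρ : ρ < r) (ht : (c + ρ + t) % f = f - 1) : p ^ f - 1 + (Lam p f t a + Lam p f t g) ≤ Lam p f t M0 := by
  have hpos : (c + t) % f = f - 1 - ρ := by
    have := pos_sub (f := f) (i := t + ρ) (t := t) (k := ρ) (y := c) rfl (by
      rw [show c + (t + ρ) = c + ρ + t by ring, ht]; omega) hf
    rw [this, show c + (t + ρ) = c + ρ + t by ring, ht]
  have h1 : Lam p f t g < lam p f t c := by
    unfold lam
    apply Dig_Lam_lt hp hf hg t _ (by omega)
    intro u hu
    by_contra hge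
    push Not at hge
    have h2 := hmin u hu _ (class_of_pos hge)
    have := Nat.mod_lt (u + t) hf
    omega
  have h2 := Lam_le p f t hM
  rw [Lam_add, Lam_singleton] at h2
  rw [add_comm, ← Lam_add]
  refine modEq_lt ?_ (by rw [Lam_add]; omega)
  exact (Nat.modEq_zero_iff_dvd.2 (dvd_Lam_of_val hp t hd)).trans (Nat.modEq_zero_iff_dvd.2 (dvd_Lam_of_val hp t hd')).symm

end Sheats



namespace Sheats

variable {p f : ℕ}

/-- label weight of items -/
def wl (p : ℕ) (S : Multiset Item) : ℕ := (S.map (fun o => (o.2 + 1) * p ^ o.1)).sum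

lemma wl_add (S T : Multiset Item) : wl p (S + T) = wl p S + wl p T := by simp [wl]

lemma wl_sum {ι : Type*} (s : Finset ι) (F : ι → Multiset Item) :
    wl p (∑ m ∈ s, F m) = ∑ m ∈ s, wl p (F m) := by
  classical
  induction s using Finset.induction_on with
  | empty => simp [wl]
  | insert a s ha ih => rw [Finset.sum_insert ha, Finset.sum_insert ha, wl_add, ih]

lemma wl_bound (m : ℕ) (S : Multiset Item) : (∀ o ∈ S, m ≤ o.2 + 1) → m * val p (S.map Prod.fst) ≤ wl p S := by
  induction S using Multiset.induction_on with
  | empty => intro; simp [wl]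
  | cons o S ih =>
    intro h
    have h1 := ih (fun o ho => h o (Multiset.mem_cons_of_mem ho))
    have h2 := h o (Multiset.mem_cons_self o S)
    rw [Multiset.map_cons, val_cons, mul_add]
    have : wl p (o ::ₘ S) = (o.2 + 1) * p ^ o.1 + wl p S := by simp [wl]
    rw [this]
    exact add_le_add (Nat.mul_le_mul_right _ h2) h1

lemma wl_total {d : ℕ} {Tot : Multiset Item} {g : ℕ → Multiset ℕ} {A : ℕ → Multiset Item} (hA : Inv p f d Tot g A) {e0 : Item}
    (he : e0 ∈ A 0) : ∑ m ∈ Finset.range (d + 1), m * val p ((A m).map Prod.fst) + (e0.2 + 1) * p ^ e0.1 ≤ wl p Tot := by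
  rw [← hA.tot, wl_sum, Finset.sum_range_succ', Finset.sum_range_succ']
  rw [zero_mul, add_zero]
  apply add_le_add
  · apply Finset.sum_le_sum
    intro m hm
    simp at hm
    exact wl_bound _ _ (hA.cap (m + 1) (by omega))
  · obtain ⟨D, hD⟩ := Multiset.exists_cons_of_mem he
    rw [hD]
    simp [wl]

/-- number of non-distinguished copies of `c` in bin `m` -/
def xc (c J : ℕ) (Z : ℕ → Multiset ℕ) (m : ℕ) : ℕ := if m = 0 then 0 else (Z m).count c - if m = J then 1 else 0

/-- the part of bin `m` that stays fixed -/
def aP (c : ℕ) (Z : ℕ → Multiset ℕ) (m : ℕ) : Multiset ℕ :=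
  if m = 0 then (Z m).filter (fun t => c ≤ t) else (Z m).filter (fun t => c < t)

/-- the mobile items with large labels -/
def itU (c J : ℕ) (Z : ℕ → Multiset ℕ) (m : ℕ) : Multiset Item :=
  ((Z m).filter (fun t => t < c)).map (fun t => (t, m)) + if m = J then {(c, J)} else 0

/-- the mobile items -/
def itA (c J : ℕ) (Z : ℕ → Multiset ℕ) (m : ℕ) : Multiset Item :=
  xc c J Z m • {(c, m - 1)} + itU c J Z m

lemma itU_fst (c J : ℕ) (Z : ℕ → Multiset ℕ) (m : ℕ) :
    (itU c J Z m).map Prod.fst = (Z m).filter (fun t => t < c) + if m = J then {c} else 0 := by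
  unfold itU
  rw [Multiset.map_add, Multiset.map_map]
  congr 1
  · simp
  · split_ifs <;> simp

lemma itA_fst (c J : ℕ) (Z : ℕ → Multiset ℕ) (m : ℕ) :
    (itA c J Z m).map Prod.fst = xc c J Z m • {c} + (itU c J Z m).map Prod.fst := by
  unfold itA
  rw [Multiset.map_add, Multiset.map_nsmul, Multiset.map_singleton]

lemma it_split {c J : ℕ} {Z : ℕ → Multiset ℕ} (hJ : c ∈ Z J) (hJ1 : 1 ≤ J) (m : ℕ) :
    Z m = aP c Z m + xc c J Z m • {c} + (itU c J Z m).map Prod.fst := by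
  rw [itU_fst]
  unfold aP xc
  by_cases hm : m = 0
  · subst hm
    have : 0 ≠ J := by omega
    simp only [if_true, if_neg this, zero_smul, add_zero]
    exact filter_split (Z 0) c
  · simp only [if_neg hm]
    by_cases hmJ : m = J
    · subst hmJ
      simp only [if_true]
      have h1 := Multiset.count_pos.2 hJ
      have h2 : (Z m).count c • ({c} : Multiset ℕ) = ((Z m).count c - 1) • {c} + {c} := by
        conv_lhs => rw [← Nat.sub_add_cancel h1, succ_nsmul]
      conv_lhs => rw [split3 (Z m) c, h2]
      abel
    · simp only [if_neg hmJ, add_zero, Nat.sub_zero]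
      exact split3 (Z m) c

lemma it_split' {c J : ℕ} {Z : ℕ → Multiset ℕ} (hJ : c ∈ Z J) (hJ1 : 1 ≤ J) (m : ℕ) :
    Z m = aP c Z m + (itA c J Z m).map Prod.fst := by
  rw [itA_fst, ← add_assoc]
  exact it_split hJ hJ1 m

lemma wl_itA {c J : ℕ} {Z : ℕ → Multiset ℕ} (hJ1 : 1 ≤ J) (m : ℕ) :
    wl p (itA c J Z m) = m * val p ((itA c J Z m).map Prod.fst) + val p ((Z m).filter (fun t => t < c)) +
      if m = J then p ^ c else 0 := by
  rw [itA_fst, itU_fst]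
  unfold itA itU
  rw [wl_add, wl_add, val_add, val_add, val_nsmul, val_singleton]
  have e1 : wl p (xc c J Z m • {(c, m - 1)}) = m * (xc c J Z m * p ^ c) := by
    have : wl p (xc c J Z m • {(c, m - 1)}) = xc c J Z m * ((m - 1 + 1) * p ^ c) := by
      simp [wl, Multiset.map_nsmul, Multiset.sum_nsmul]
    rw [this]
    by_cases hm : m = 0
    · subst hm; simp [xc]
    · rw [Nat.sub_add_cancel (by omega)]; ring
  have e2 : wl p (((Z m).filter (fun t => t < c)).map (fun t => (t, m))) = (m + 1) * val p ((Z m).filter (fun t => t < c)) := by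
    unfold wl val
    rw [Multiset.map_map, ← Multiset.sum_map_mul_left]; rfl
  rw [e1, e2]
  split_ifs with h
  · subst h
    simp [wl]; ring
  · simp [wl]; ring

lemma xc_le {n c J : ℕ} {K : Multiset ℕ} {Z : ℕ → Multiset ℕ} (hK : ∀ t, K.count t ≤ p - 1) (hZ : IsComp p f (n + 1) K Z)
    (hJ2 : J ≤ n + 1) (hJ : c ∈ Z J) (m : ℕ) (hm : m ≤ n + 1) : xc c J Z m ≤ p - 2 := by
  unfold xc
  split_ifs with h0 h1
  · omega
  · have := (Multiset.count_le_of_le c (hZ.le hm)).trans (hK c)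
    omega
  · have h2 := hK c
    have h3 := Multiset.count_pos.2 hJ
    rw [← hZ.tot, Multiset.count_sum'] at h2
    have h4 : (Z m).count c + (Z J).count c ≤ ∑ m ∈ Finset.range (n + 1 + 1), (Z m).count c := by
      rw [← Finset.sum_pair (f := fun m => (Z m).count c) h1]
      apply Finset.sum_le_sum_of_subset
      intro t ht
      simp at ht ⊢
      omega
    omega

lemma Lam_fst_sum {ι : Type*} (s : Finset ι) (F : ι → Multiset Item) :
    (∑ m ∈ s, F m).map Prod.fst = ∑ m ∈ s, (F m).map Prod.fst := by
  classical
  induction s using Finset.induction_on with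
  | empty => simp
  | insert a s ha ih => rw [Finset.sum_insert ha, Finset.sum_insert ha, Multiset.map_add, ih]

theorem exchange_nonempty (hp : 2 ≤ p) (hf : 0 < f) {n : ℕ} {K : Multiset ℕ} {M Z : ℕ → Multiset ℕ} (hK : ∀ t, K.count t ≤ p - 1)
    (hM : IsComp p f (n + 1) K M) (hZ : IsComp p f (n + 1) K Z)
    (hmax : ∀ Y, IsComp p f (n + 1) K Y → val p (Y 0) ≤ val p (M 0)) {c : ℕ}
    (hlt : (Z 0).count c < (M 0).count c) (hgt : ∀ t, c < t → (Z 0).count t = (M 0).count t)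
    (hV : (Z 0).filter (fun t => t < c) ≠ 0) : ∃ Y, IsComp p f (n + 1) K Y ∧ wt p (n + 1) Y < wt p (n + 1) Z := by
  have hq := q1_pos hp hf
  obtain ⟨J, hJ1, hJ2, hJ⟩ := exists_J hM hZ hlt
  obtain ⟨g0, hg0, hg0ne, hgV⟩ := exists_rep hp hf hV
  obtain ⟨r, hr, ⟨u, hu, hur⟩, hmin⟩ := exists_r hf hg0ne c
  obtain ⟨i, hir, hpos, hA, hAd⟩ := choose_cut hp hf hK hM hZ hmax hlt hgt hg0 hgV hg0ne hr hmin
  set a := aP c Z with ha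
  set V := fun m => (Z m).filter (fun t => t < c) with hVdef
  have ha0 : a 0 = (Z 0).filter (fun t => c ≤ t) := by simp [ha, aP]
  have ham : ∀ m, 1 ≤ m → a m = (Z m).filter (fun t => c < t) := by
    intro m hm
    have : m ≠ 0 := by omega
    simp [ha, aP, this]
  let g : ℕ → Multiset ℕ := fun m => if m = 0 then g0 else digs p f i (p ^ f - 1 - Lam p f i (a m))
  have hgm : ∀ m, 1 ≤ m → g m = digs p f i (p ^ f - 1 - Lam p f i (a m)) := by
    intro m hm
    have : m ≠ 0 := by omega
    simp [g, this]
  have hapos : ∀ m, 1 ≤ m → m ≤ n + 1 → ∀ y ∈ a m, (c + i) % f + r < (y + i) % f := by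
    intro m h1 h2 y hy
    rw [ham m h1, Multiset.mem_filter] at hy
    exact hpos m h1 h2 y hy.1 hy.2
  have hZ0 : Z 0 = a 0 + V 0 := by rw [ha0]; exact filter_split (Z 0) c
  have hag0 : p ^ f - 1 ∣ val p (a 0 + g 0) := by
    have h1 := hZ.dvd 0 (by omega)
    rw [hZ0, val_add] at h1
    rw [val_add]
    exact (Nat.modEq_zero_iff_dvd.1 ((hgV.add_left (val p (a 0))).trans (Nat.modEq_zero_iff_dvd.2 h1)))
  have htm : ∀ m, 1 ≤ m → m < n + 1 → _ := fun m h1 h2 =>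
    target_mid hp hf hir (hapos m h1 h2.le) (by rw [ham m h1]; exact hA m h1 h2)
  have hag : ∀ m < n + 1, p ^ f - 1 ∣ val p (a m + g m) := by
    intro m hm
    by_cases h : m = 0
    · rw [h]; exact hag0
    · rw [hgm m (by omega)]; exact (htm m (by omega) hm).1
  set A0 := itA c J Z with hA0
  set Tot := ∑ m ∈ Finset.range (n + 1 + 1), A0 m with hTot
  have hKT : K = ∑ m ∈ Finset.range (n + 1 + 1), a m + Tot.map Prod.fst := by
    rw [hTot, Lam_fst_sum, ← Finset.sum_add_distrib, ← hZ.tot]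
    exact Finset.sum_congr rfl (fun m _ => it_split' hJ hJ1 m)
  have hUfacts : ∀ m, 1 ≤ m → m < n + 1 → _ := fun m h1 h2 =>
    cover_U hp hf hir (it_split hJ hJ1 m) (hZ.ne m h2) (hZ.dvd m h2) (xc_le hK hZ hJ2 hJ m h2.le) (hapos m h1 h2.le)
      (by rw [← ha, ham m h1]; exact hA m h1 h2)
  have hUA : ∀ m, itU c J Z m ≤ A0 m := fun m => Multiset.le_add_left _ _
  -- the initial invariant
  have hInv : Inv p f (n + 1) Tot g A0 := by
    refine ⟨rfl, ?_, ?_, ?_⟩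
    · intro m hm o ho
      rw [hA0, itA, itU] at ho
      rcases Multiset.mem_add.1 ho with h | h
      · have := Multiset.mem_of_mem_nsmul h
        simp at this
        subst this
        simp only
        omega
      · rcases Multiset.mem_add.1 h with h | h
        · obtain ⟨t, ht, rfl⟩ := Multiset.mem_map.1 h
          simp
        · split_ifs at h with hmJ
          · simp at h
            subst h
            simp only
            omega
          · simp at h
    · intro m hm
      have h1 := hZ.dvd m hm
      rw [it_split' hJ hJ1 m, val_add] at h1
      have h2 := hag m hm
      rw [val_add] at h2
      exact Nat.ModEq.add_left_cancel' _ ((Nat.modEq_zero_iff_dvd.2 h1).trans (Nat.modEq_zero_iff_dvd.2 h2).symm)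
    · intro m h1 h2 h0
      have h3 := (hUfacts m h1 h2).1
      have h4 := hUA m
      rw [h0, Multiset.le_zero] at h4
      rw [h4] at h3
      simp at h3
  have hA00 : (A0 0).map Prod.fst = V 0 := by
    have : 0 ≠ J := by omega
    rw [hA0, itA_fst, itU_fst]
    simp [xc, this, hVdef]
  obtain ⟨Q, QT, hQ, hQr⟩ := pack (ε := Prod.fst) hp hf {c + r} (A0 0) (by
    intro j
    rw [hA00, Lam_singleton]
    have h1 := Lam_of_dig hp hf hV hg0 hgV.symm j
    have h2 : lam p f j u ≤ Lam p f j g0 := by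
      have := Lam_le p f j (Multiset.singleton_le.2 hu)
      simpa using this
    rw [← lam_congr p f (show (u + j) % f = (c + r + j) % f from Nat.ModEq.add_right j hur)]
    exact h2.trans h1)
  have hState : State p f (n + 1) c A0 r 1 Q (itU c J Z) := by
    refine ⟨?_, realizes_singleton hp hQr, ?_, le_rfl, by omega, ?_, ?_, ?_⟩
    · rw [hQ]; exact Multiset.le_add_right _ _
    · intro o _; omega
    · intro m _ _; exact hUA m
    · intro m h1 h2 o ho
      rw [itU] at ho
      rcases Multiset.mem_add.1 ho with h | h
      · obtain ⟨t, ht, rfl⟩ := Multiset.mem_map.1 h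
        simp
      · split_ifs at h with hmJ
        · simp at h
          subst h
          simp only
          omega
        · simp at h
    · intro m h1 h2 j
      rw [if_neg (by omega)]
      exact (hUfacts m h1 h2).2 j
  have he0 : (c, J) ∈ Tot := by
    rw [hTot, Multiset.mem_sum]
    refine ⟨J, by simp; omega, Multiset.mem_of_le (hUA J) ?_⟩
    simp [itU]
  obtain ⟨A', hA', heA⟩ := engine hp hf (c := c) (d := n + 1) (g := g) (r := r) (e0 := (c, J)) rfl he0 (by
      intro m h1 h2 j
      rw [hgm m h1]
      exact (htm m h1 h2).2.1 j) (by
      intro ρ hρ t ht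
      have h1 := first_le hp hf (by rw [ha0]; exact top_le hlt hgt) (hM.dvd 0 (by omega)) hag0 hg0 hr hmin hρ ht
      have h2 := last_le (b := M (n + 1)) hp hf (hapos (n + 1) (by omega) le_rfl) (by rw [ham _ (by omega)]; exact hAd) hρ ht
      have h3 : ∑ m ∈ Finset.range n, (Lam p f t (a (m + 1)) + Lam p f t (g (m + 1))) ≤
          ∑ m ∈ Finset.range n, Lam p f t (M (m + 1)) := by
        apply Finset.sum_le_sum
        intro m hm
        simp at hm
        rw [hgm (m + 1) (by omega)]
        exact ((htm (m + 1) (by omega) (by omega)).2.2 ρ hρ t ht).trans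
          (q1_le_Lam hp t (hM.ne _ (by omega)) (hM.dvd _ (by omega)))
      have h4 := hM.Lam_split t
      rw [hKT, Lam_add, Lam_sum, Finset.sum_range_succ, Finset.sum_range_succ'] at h4
      rw [Finset.sum_add_distrib] at h3
      rw [Finset.sum_range_succ']
      have h5 : g 0 = g0 := rfl
      rw [h5] at h1 ⊢
      omega)
    r le_rfl _ A0 1 Q _ rfl hInv hState
  refine ⟨fun m => a m + (A' m).map Prod.fst, ⟨?_, ?_, ?_⟩, ?_⟩
  · rw [Finset.sum_add_distrib, ← Lam_fst_sum, hA'.tot, ← hKT]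
  · intro m hm h0
    have h1 := (add_eq_zero.1 h0).2
    rw [Multiset.map_eq_zero] at h1
    by_cases h : m = 0
    · subst h
      rw [h1] at heA
      simp at heA
    · exact hA'.ne m (by omega) hm h1
  · intro m hm
    simp only [val_add]
    have h1 := hag m hm
    rw [val_add] at h1
    exact Nat.modEq_zero_iff_dvd.1 (((hA'.cong m hm).add_left (val p (a m))).trans (Nat.modEq_zero_iff_dvd.2 h1))
  · have h1 := wl_total hA' heA
    have h2 : wl p Tot = ∑ m ∈ Finset.range (n + 1 + 1), m * val p ((A0 m).map Prod.fst) +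
        ∑ m ∈ Finset.range (n + 1 + 1), val p (V m) + p ^ c := by
      rw [hTot, wl_sum]
      simp_rw [hA0, wl_itA hJ1]
      rw [Finset.sum_add_distrib, Finset.sum_add_distrib, Finset.sum_ite_eq']
      rw [if_pos (by simp; omega)]
    have h3 : ∑ m ∈ Finset.range (n + 1 + 1), val p (V m) < p ^ c := by
      rw [← val_sum]
      have hle : ∑ m ∈ Finset.range (n + 1 + 1), V m ≤ K := by
        rw [← hZ.tot]
        exact Finset.sum_le_sum (fun m _ => Multiset.filter_le _ _)
      apply val_lt hp (fun t => (Multiset.count_le_of_le t hle).trans (hK t))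
      intro t ht
      obtain ⟨m, _, hm⟩ := Multiset.mem_sum.1 ht
      exact (Multiset.mem_filter.1 hm).2
    have h4 : wt p (n + 1) Z = ∑ m ∈ Finset.range (n + 1 + 1), m * val p (a m) +
        ∑ m ∈ Finset.range (n + 1 + 1), m * val p ((A0 m).map Prod.fst) := by
      unfold wt
      rw [← Finset.sum_add_distrib]
      apply Finset.sum_congr rfl
      intro m _
      conv_lhs => rw [it_split' hJ hJ1 m, val_add, mul_add]
    have h5 : wt p (n + 1) (fun m => a m + (A' m).map Prod.fst) = ∑ m ∈ Finset.range (n + 1 + 1), m * val p (a m) +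
        ∑ m ∈ Finset.range (n + 1 + 1), m * val p ((A' m).map Prod.fst) := by
      unfold wt
      rw [← Finset.sum_add_distrib]
      apply Finset.sum_congr rfl
      intro m _
      rw [val_add, mul_add]
    rw [h4, h5]
    have h6 : 1 * p ^ c ≤ J * p ^ c := Nat.mul_le_mul_right _ hJ1
    simp only [add_mul] at h1
    omega

theorem exchange (hp : 2 ≤ p) (hf : 0 < f) {n : ℕ} {K : Multiset ℕ} {M Z : ℕ → Multiset ℕ} (hK : ∀ t, K.count t ≤ p - 1)
    (hM : IsComp p f (n + 1) K M) (hZ : IsComp p f (n + 1) K Z)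
    (hmax : ∀ Y, IsComp p f (n + 1) K Y → val p (Y 0) ≤ val p (M 0)) (hne : Z 0 ≠ M 0) :
    ∃ Y, IsComp p f (n + 1) K Y ∧ wt p (n + 1) Y < wt p (n + 1) Z := by
  obtain ⟨c, hc, hgt⟩ := exists_top hne
  have hlt : (Z 0).count c < (M 0).count c := by
    by_contra hge
    have h1 := lt_of_top hp (X := M 0) (Y := Z 0)
      (fun t => (Multiset.count_le_of_le t (hM.le (Nat.zero_le _))).trans (hK t)) (e := c) (by omega) (fun t ht => (hgt t ht).symm)
    have h2 := hmax Z hZ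
    omega
  by_cases hV : (Z 0).filter (fun t => t < c) = 0
  · exact exchange_empty hp hf hK hM hZ hmax hlt hgt hV
  · exact exchange_nonempty hp hf hK hM hZ hmax hlt hgt hV

lemma IsComp.tail {n : ℕ} {K a : Multiset ℕ} {Y : ℕ → Multiset ℕ} (h : IsComp p f (n + 1) (a + K) Y) (h0 : Y 0 = a) :
    IsComp p f n K (fun m => Y (m + 1)) := by
  refine ⟨?_, fun m hm => h.ne _ (by omega), fun m hm => h.dvd _ (by omega)⟩
  have := h.tot
  rw [Finset.sum_range_succ', h0, add_comm] at this
  exact add_left_cancel this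

/-- Combinatorial main theorem. -/
theorem main_comb (hp : 2 ≤ p) (hf : 0 < f) : ∀ d, ∀ (K : Multiset ℕ) (M : ℕ → Multiset ℕ), (∀ t, K.count t ≤ p - 1) →
    IsComp p f d K M →
    (∀ Y, IsComp p f d K Y → ∀ m ≤ d, (∀ j < m, val p (Y j) = val p (M j)) → val p (Y m) ≤ val p (M m)) →
    ∀ w, ∀ Z, wt p d Z = w → IsComp p f d K Z → (∃ m ≤ d, Z m ≠ M m) → wt p d M < wt p d Z := by
  intro d
  induction d with
  | zero =>
    intro K M hK hM hmax w Z hw hZ ⟨m, hm, hne⟩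
    obtain rfl : m = 0 := by omega
    have h1 := hM.tot
    have h2 := hZ.tot
    simp at h1 h2
    exact absurd (h2.trans h1.symm) hne
  | succ n ih =>
    intro K M hK hM hmax w
    induction w using Nat.strong_induction_on with
    | _ w ihw =>
      intro Z hw hZ ⟨m, hm, hne⟩
      by_cases h0 : Z 0 = M 0
      · obtain ⟨R, hR⟩ := Multiset.le_iff_exists_add.1 (hM.le (Nat.zero_le _))
        rw [hR] at hM hZ
        have hMt := hM.tail rfl
        have hZt := hZ.tail h0
        have hRc : ∀ t, R.count t ≤ p - 1 := fun t =>
          (Multiset.count_le_of_le t (by rw [hR]; exact Multiset.le_add_left _ _)).trans (hK t)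
        have hm0 : m ≠ 0 := by rintro rfl; exact hne h0
        have key := ih R (fun m => M (m + 1)) hRc hMt (by
          intro Y hY m hm hj
          have hc := hY.cons (a := M 0) (hM.ne 0 (by omega)) (hM.dvd 0 (by omega))
          rw [← hR] at hc
          have := hmax _ hc (m + 1) (by omega) (by
            intro j hjm
            cases j with
            | zero => rfl
            | succ j => exact hj j (by omega))
          exact this) _ (fun m => Z (m + 1)) rfl hZt ⟨m - 1, by omega, by
            rwa [Nat.sub_add_cancel (by omega)]⟩
        rw [wt_shift, wt_shift, hMt.tot, hZt.tot]
        omega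
      · obtain ⟨Y, hY, hYw⟩ := exchange hp hf hK hM hZ (fun Y hY => hmax Y hY 0 (by omega) (by simp)) h0
        by_cases hYM : ∃ m ≤ n + 1, Y m ≠ M m
        · have := ihw _ (by omega) Y rfl hY hYM
          omega
        · push Not at hYM
          have : wt p (n + 1) M = wt p (n + 1) Y := by
            unfold wt
            apply Finset.sum_congr rfl
            intro m hm
            simp at hm
            rw [hYM m (by omega)]
          omega

end Sheats



namespace Sheats

variable {p f : ℕ}

/-- multiset of base-`p` digits -/
def dg (p n : ℕ) : Multiset ℕ := ∑ k ∈ Finset.range n, (n / p ^ k % p) • {k}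

lemma count_dg (hp : 2 ≤ p) (n t : ℕ) : (dg p n).count t = n / p ^ t % p := by
  unfold dg
  rw [Multiset.count_sum']
  simp only [Multiset.count_nsmul, Multiset.count_singleton, mul_ite, mul_one, mul_zero]
  rw [Finset.sum_ite_eq]
  split_ifs with h
  · rfl
  · simp at h
    have : n < p ^ t := h.trans_lt (Nat.lt_pow_self hp)
    rw [Nat.div_eq_of_lt this, Nat.zero_mod]

lemma val_dg (hp : 2 ≤ p) (n : ℕ) : val p (dg p n) = n := by
  unfold dg
  rw [val_sum]
  simp only [val_nsmul, val_singleton]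
  rw [digit_sum, Nat.mod_eq_of_lt (Nat.lt_pow_self hp)]

lemma count_dg_le (hp : 2 ≤ p) (n t : ℕ) : (dg p n).count t ≤ p - 1 := by
  rw [count_dg hp]
  have := Nat.mod_lt (n / p ^ t) (by omega : 0 < p)
  omega

lemma digit_val (hp : 2 ≤ p) {Y : Multiset ℕ} (hY : ∀ t, Y.count t ≤ p - 1) (t : ℕ) : val p Y / p ^ t % p = Y.count t := by
  rw [← count_dg hp, val_inj hp (count_dg_le hp _) hY (val_dg hp (val p Y))]

/-- bins from a tuple -/
def toBins (p : ℕ) {d : ℕ} (m : Fin (d + 1) → ℕ) (j : ℕ) : Multiset ℕ := dg p (m (Fin.ofNat (d + 1) (d - j)))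

lemma ofNat_rev {d : ℕ} (i : Fin (d + 1)) : Fin.ofNat (d + 1) (d - (i : ℕ)) = Fin.rev i := by
  ext
  simp only [Fin.ofNat, Fin.val_rev]
  rw [Nat.mod_eq_of_lt (by omega)]
  omega

lemma sum_toBins {d : ℕ} {α : Type*} [AddCommMonoid α] (m : Fin (d + 1) → ℕ) (F : ℕ → ℕ → α) :
    ∑ j ∈ Finset.range (d + 1), F j (m (Fin.ofNat (d + 1) (d - j))) = ∑ i : Fin (d + 1), F (d - i) (m i) := by
  rw [Finset.sum_range]
  rw [← Equiv.sum_comp Fin.revPerm]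
  apply Finset.sum_congr rfl
  intro i _
  rw [Fin.revPerm_apply, ofNat_rev, Fin.rev_rev]
  congr 1
  rw [Fin.val_rev]
  omega

lemma isComp_of_mem (hp : 2 ≤ p) {d k : ℕ} {m : Fin (d + 1) → ℕ} (hm : m ∈ Uset p (p ^ f) d k) :
    IsComp p f d (dg p k) (toBins p m) := by
  obtain ⟨⟨h1, h2⟩, h3⟩ := hm
  have key : ∀ j < d, 0 < m (Fin.ofNat (d + 1) (d - j)) ∧ (p ^ f - 1) ∣ m (Fin.ofNat (d + 1) (d - j)) := by
    intro j hj
    apply h3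
    simp only [Fin.ofNat]
    rw [Nat.mod_eq_of_lt (by omega)]
    omega
  refine ⟨?_, ?_, ?_⟩
  · ext t
    rw [Multiset.count_sum', count_dg hp, ← h2 t]
    unfold toBins
    rw [sum_toBins m (fun _ x => (dg p x).count t)]
    simp only [count_dg hp]
  · intro j hj h0
    have h4 := (key j hj).1
    have h5 := val_dg hp (m (Fin.ofNat (d + 1) (d - j)))
    unfold toBins at h0
    rw [h0] at h5
    rw [val_zero] at h5
    omega
  · intro j hj
    unfold toBins
    rw [val_dg hp]
    exact (key j hj).2

lemma wt_toBins (hp : 2 ≤ p) {d : ℕ} (m : Fin (d + 1) → ℕ) : wt p d (toBins p m) = wtU m := by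
  unfold wt wtU toBins
  rw [sum_toBins m (fun j x => j * val p (dg p x))]
  simp only [val_dg hp]

lemma mem_of_isComp (hp : 2 ≤ p) {d k : ℕ} {Y : ℕ → Multiset ℕ} (hY : IsComp p f d (dg p k) Y) :
    (fun i : Fin (d + 1) => val p (Y (d - i))) ∈ Uset p (p ^ f) d k := by
  have hc : ∀ m ≤ d, ∀ t, (Y m).count t ≤ p - 1 := fun m hm t =>
    (Multiset.count_le_of_le t (hY.le hm)).trans (count_dg_le hp k t)
  have hsum : ∀ F : ℕ → ℕ, ∑ i : Fin (d + 1), F (d - i) = ∑ j ∈ Finset.range (d + 1), F j := by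
    intro F
    rw [← Finset.sum_range_reflect, Finset.sum_range]
    apply Finset.sum_congr rfl
    intro i _
    congr 1
  refine ⟨⟨?_, ?_⟩, ?_⟩
  · rw [hsum (fun j => val p (Y j)), ← val_sum, hY.tot, val_dg hp]
  · intro t
    rw [hsum (fun j => val p (Y j) / p ^ t % p), ← count_dg hp, ← hY.tot, Multiset.count_sum']
    apply Finset.sum_congr rfl
    intro j hj
    simp at hj
    exact digit_val hp (hc j (by omega)) t
  · intro i hi
    exact ⟨val_pos hp (hY.ne _ (by omega)), hY.dvd _ (by omega)⟩

theorem part_one (hp : 2 ≤ p) (hf : 0 < f) {d k : ℕ} {M : Fin (d + 1) → ℕ} (hM : M ∈ Uset p (p ^ f) d k)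
    (hmax : ∀ m ∈ Uset p (p ^ f) d k, LexLE (m ∘ Fin.rev) (M ∘ Fin.rev)) :
    ∀ m ∈ Uset p (p ^ f) d k, m ≠ M → wtU M < wtU m := by
  intro m hm hne
  rw [← wt_toBins hp, ← wt_toBins hp]
  refine main_comb hp hf d (dg p k) _ (count_dg_le hp k) (isComp_of_mem hp hM) ?_ _ _ rfl (isComp_of_mem hp hm) ?_
  · intro Y hY j hj hagree
    have hMv : ∀ i : Fin (d + 1), val p (toBins p M i) = (M ∘ Fin.rev) i := by
      intro i
      unfold toBins
      rw [val_dg hp, ofNat_rev]; rfl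
    have hYv : ∀ i : Fin (d + 1), val p (Y i) = ((fun i : Fin (d + 1) => val p (Y (d - i))) ∘ Fin.rev) i := by
      intro i
      simp only [Function.comp, Fin.val_rev]
      congr 2
      omega
    let J : Fin (d + 1) := ⟨j, by omega⟩
    have e1 := hMv J
    have e2 := hYv J
    change val p (toBins p M j) = _ at e1
    change val p (Y j) = _ at e2
    rw [e1, e2]
    rcases hmax _ (mem_of_isComp hp hY) with h | ⟨i, h1, h2⟩
    · rw [h]
    · rcases lt_trichotomy i J with h | h | h
      · have := hagree i h
        rw [hMv, hYv] at this
        omega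
      · rw [← h]; exact h2.le
      · exact (h1 J h).le
  · by_contra hno
    push Not at hno
    apply hne
    funext i
    have h1 := hno (d - i) (by omega)
    unfold toBins at h1
    have h2 : Fin.ofNat (d + 1) (d - (d - (i : ℕ))) = i := by
      ext
      simp only [Fin.ofNat]
      rw [Nat.mod_eq_of_lt (by omega)]
      omega
    rw [h2] at h1
    rw [← val_dg hp (m i), h1, val_dg hp]

end Sheats



namespace Sheats

open Polynomial

lemma padic_sum_factorial {p : ℕ} [hp : Fact p.Prime] {n k b : ℕ} (m : Fin n → ℕ) (hm : ∑ i, m i = k)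
    (hb : Nat.log p k < b) :
    padicValNat p (Nat.multinomial Finset.univ m) + ∑ j ∈ Finset.Ico 1 b, ∑ i, m i / p ^ j
      = ∑ j ∈ Finset.Ico 1 b, k / p ^ j := by
  have h1 := Nat.multinomial_spec Finset.univ m
  rw [hm] at h1
  have h2 := congrArg (padicValNat p) h1
  have h0 : ∀ i, (m i).factorial ≠ 0 := fun i => Nat.factorial_ne_zero _
  rw [padicValNat.mul (Finset.prod_ne_zero_iff.2 fun i _ => h0 i) (Nat.multinomial_pos _ _).ne',
    padicValNat_factorial hb] at h2
  have h3 : padicValNat p (∏ i, (m i).factorial) = ∑ i, padicValNat p ((m i).factorial) := by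
    have : ∀ s : Finset (Fin n), padicValNat p (∏ i ∈ s, (m i).factorial)
        = ∑ i ∈ s, padicValNat p ((m i).factorial) := by
      intro s
      induction s using Finset.induction_on with
      | empty => simp
      | insert a s ha ih =>
        rw [Finset.prod_insert ha, Finset.sum_insert ha,
          padicValNat.mul (h0 a) (Finset.prod_ne_zero_iff.2 fun i _ => h0 i), ih]
    exact this _
  rw [h3] at h2
  rw [← h2, add_comm, Finset.sum_comm]
  congr 1
  apply Finset.sum_congr rfl
  intro i _
  rw [padicValNat_factorial]
  refine lt_of_le_of_lt (Nat.log_mono_right ?_) hb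
  rw [← hm]
  exact Finset.single_le_sum (f := m) (fun _ _ => Nat.zero_le _) (Finset.mem_univ i)

lemma sum_div_le {p n k : ℕ} (hp : 0 < p) (m : Fin n → ℕ) (hm : ∑ i, m i = k) (j : ℕ) :
    ∑ i, m i / p ^ j ≤ k / p ^ j := by
  rw [Nat.le_div_iff_mul_le (by positivity), Finset.sum_mul, ← hm]
  exact Finset.sum_le_sum fun i _ => Nat.div_mul_le_self _ _

lemma noCarry_iff_div {p n k : ℕ} (hp : 0 < p) (m : Fin n → ℕ) :
    NoCarry p m k ↔ ∀ j, ∑ i, m i / p ^ j = k / p ^ j := by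
  have hd : ∀ x j : ℕ, x / p ^ j = p * (x / p ^ (j + 1)) + x / p ^ j % p := by
    intro x j
    rw [pow_succ, ← Nat.div_div_eq_div_mul, Nat.div_add_mod]
  have hs : ∀ j : ℕ, ∑ i, m i / p ^ j = p * ∑ i, (m i / p ^ (j + 1)) + ∑ i, m i / p ^ j % p := by
    intro j
    rw [Finset.mul_sum, ← Finset.sum_add_distrib]
    exact Finset.sum_congr rfl fun i _ => hd _ _
  constructor
  · rintro ⟨h1, h2⟩ j
    induction j with
    | zero => simpa using h1
    | succ j ih =>
      have hk := hd k j
      rw [hs, h2] at ih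
      exact Nat.eq_of_mul_eq_mul_left hp (by omega)
  · intro h
    refine ⟨by simpa using h 0, fun j => ?_⟩
    have h1 := h j
    rw [hs, h (j + 1), hd k j] at h1
    omega

lemma noCarry_iff_multinomial {p n k : ℕ} (hp : p.Prime) (m : Fin n → ℕ) (hm : ∑ i, m i = k) :
    NoCarry p m k ↔ ¬ p ∣ Nat.multinomial Finset.univ m := by
  have : Fact p.Prime := ⟨hp⟩
  have hne : Nat.multinomial Finset.univ m ≠ 0 := (Nat.multinomial_pos _ _).ne'
  rw [noCarry_iff_div hp.pos]
  constructor
  · intro h hdvd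
    have h1 := padic_sum_factorial (p := p) m hm (Nat.lt_succ_self _)
    rw [Finset.sum_congr rfl fun j _ => h j] at h1
    have := one_le_padicValNat_of_dvd hne hdvd
    omega
  · intro h j
    have h1 := padic_sum_factorial (p := p) (b := Nat.log p k + 1 + j + 1) m hm (by omega)
    rw [padicValNat.eq_zero_of_not_dvd h, zero_add] at h1
    rcases Nat.eq_zero_or_pos j with rfl | hj
    · simpa using hm
    · exact (Finset.sum_eq_sum_iff_of_le fun j _ => sum_div_le hp.pos m hm j).1 h1 j
        (Finset.mem_Ico.2 ⟨hj, by omega⟩)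

lemma sum_pow_field {Fq : Type} [Field Fq] [Fintype Fq] (n : ℕ) :
    (0 < n ∧ (Fintype.card Fq - 1) ∣ n → ∑ x : Fq, x ^ n = -1) ∧
    (¬ (0 < n ∧ (Fintype.card Fq - 1) ∣ n) → ∑ x : Fq, x ^ n = 0) := by
  classical
  rcases Nat.eq_zero_or_pos n with rfl | hn
  · simp
  · have h : ∑ x : Fq, x ^ n = if Fintype.card Fq - 1 ∣ n then -1 else 0 := by
      rw [← FiniteField.sum_pow_units]
      let φ : Fqˣ ↪ Fq := ⟨fun x ↦ x, Units.val_injective⟩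
      have : Finset.univ.map φ = Finset.univ \ {0} := by
        ext x
        simpa only [Finset.mem_map, Finset.mem_univ, Function.Embedding.coeFn_mk, true_and,
          Finset.mem_sdiff, Finset.mem_singleton, φ] using! isUnit_iff_ne_zero
      calc
        ∑ x : Fq, x ^ n = ∑ x ∈ Finset.univ \ {(0 : Fq)}, x ^ n := by
          rw [← Finset.sum_sdiff ({0} : Finset Fq).subset_univ, Finset.sum_singleton,
            zero_pow hn.ne', add_zero]
        _ = ∑ x : Fqˣ, (x ^ n : Fq) := by simp [φ, ← this, Finset.univ.sum_map φ]
    simp only [hn, true_and, h]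
    constructor
    · intro h; simp [h]
    · intro h; simp [h]

/-- coefficient of the monomial term indexed by `m` -/
noncomputable def T (Fq : Type) [Field Fq] [Fintype Fq] {d : ℕ} (m : Fin (d + 1) → ℕ) : Fq :=
  (Nat.multinomial Finset.univ m : Fq) * ∏ i : Fin d, ∑ x : Fq, x ^ m i.succ

lemma powerSum_eq (Fq : Type) [Field Fq] [Fintype Fq] (d k : ℕ) :
    powerSum Fq d k = ∑ m ∈ Finset.piAntidiag (Finset.univ : Finset (Fin (d + 1))) k,
      C (T Fq m) * X ^ wtU m := by
  classical
  unfold powerSum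
  have h1 : ∀ c : Fin d → Fq, (X ^ d + ∑ i : Fin d, C ((c ∘ Fin.rev) i) * X ^ (i : ℕ) : Fq[X]) =
      ∑ i : Fin (d + 1), C ((Fin.cons 1 c : Fin (d + 1) → Fq) i) * X ^ (d - (i : ℕ)) := by
    intro c
    rw [Fin.sum_univ_succ]
    simp only [Fin.cons_zero, map_one, one_mul, Fin.val_zero, Nat.sub_zero, Fin.cons_succ]
    congr 1
    rw [← Equiv.sum_comp Fin.revPerm]
    apply Finset.sum_congr rfl
    intro i _
    simp only [Function.comp, Fin.revPerm_apply, Fin.rev_rev, Fin.val_rev, Fin.val_succ]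
  have h2 : (∑ c : Fin d → Fq, (X ^ d + ∑ i : Fin d, C (c i) * X ^ (i : ℕ)) ^ k : Fq[X]) =
      ∑ c : Fin d → Fq, (X ^ d + ∑ i : Fin d, C ((c ∘ Fin.rev) i) * X ^ (i : ℕ)) ^ k := by
    rw [← Equiv.sum_comp (Equiv.arrowCongr (Fin.revPerm (n := d)) (Equiv.refl Fq))]
    apply Finset.sum_congr rfl
    intro c _
    rfl
  rw [h2]
  simp only [h1, Finset.sum_pow_eq_sum_piAntidiag]
  rw [Finset.sum_comm]
  apply Finset.sum_congr rfl
  intro m _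
  unfold T wtU
  rw [← Finset.mul_sum]
  simp only [mul_pow, Finset.prod_mul_distrib, ← pow_mul, Finset.prod_pow_eq_pow_sum]
  rw [← Finset.sum_mul, ← mul_assoc, map_mul, map_natCast]
  congr 2
  rw [Finset.prod_univ_sum, map_sum, Fintype.piFinset_univ]
  apply Finset.sum_congr rfl
  intro c _
  rw [Fin.prod_univ_succ]
  simp

lemma T_ne_zero_iff {p f : ℕ} (hp : p.Prime) (Fq : Type) [Field Fq] [Fintype Fq]
    (hcard : Fintype.card Fq = p ^ f) {d k : ℕ} (m : Fin (d + 1) → ℕ) (hm : ∑ i, m i = k) :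
    T Fq m ≠ 0 ↔ m ∈ Uset p (p ^ f) d k := by
  have : Fact p.Prime := ⟨hp⟩
  have : CharP Fq p := charP_of_card_eq_prime_pow hcard
  unfold T Uset
  rw [mul_ne_zero_iff, Set.mem_ofPred_eq, noCarry_iff_multinomial hp m hm, Ne, CharP.cast_eq_zero_iff Fq p]
  apply and_congr_right
  intro _
  rw [Finset.prod_ne_zero_iff]
  have key : ∀ n : ℕ, ∑ x : Fq, x ^ n ≠ 0 ↔ 0 < n ∧ (p ^ f - 1) ∣ n := by
    intro n
    have := sum_pow_field (Fq := Fq) n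
    rw [hcard] at this
    by_cases h : 0 < n ∧ (p ^ f - 1) ∣ n
    · rw [this.1 h]; simp [h]
    · rw [this.2 h]; simp only [ne_eq, not_true_eq_false, h]
  constructor
  · intro h i hi
    obtain ⟨j, rfl⟩ := Fin.exists_succ_eq.2 (show i ≠ 0 by rintro rfl; simp at hi)
    exact (key _).1 (h j (Finset.mem_univ _))
  · intro h i _
    exact (key _).2 (h _ (by simp))

lemma part_two {p f : ℕ} (hp : p.Prime) (Fq : Type) [Field Fq] [Fintype Fq]
    (hcard : Fintype.card Fq = p ^ f) {d k : ℕ} {M : Fin (d + 1) → ℕ} (hM : M ∈ Uset p (p ^ f) d k)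
    (hmin : ∀ m ∈ Uset p (p ^ f) d k, m ≠ M → wtU M < wtU m) :
    (powerSum Fq d k).natTrailingDegree = wtU M := by
  have hco : ∀ w, (powerSum Fq d k).coeff w =
      ∑ m ∈ Finset.piAntidiag (Finset.univ : Finset (Fin (d + 1))) k,
        if w = wtU m then T Fq m else 0 := by
    intro w
    rw [powerSum_eq, finsetSum_coeff]
    simp only [coeff_C_mul_X_pow]
  have hz : ∀ m ∈ Finset.piAntidiag (Finset.univ : Finset (Fin (d + 1))) k, wtU m ≤ wtU M → m ≠ M →
      T Fq m = 0 := by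
    intro m hm hw hne
    by_contra h0
    have := hmin m ((T_ne_zero_iff hp Fq hcard m (Finset.mem_piAntidiag.1 hm).1).1 h0) hne
    omega
  have hMmem : M ∈ Finset.piAntidiag (Finset.univ : Finset (Fin (d + 1))) k :=
    Finset.mem_piAntidiag.2 ⟨hM.1.1, by simp⟩
  have hlead : (powerSum Fq d k).coeff (wtU M) ≠ 0 := by
    rw [hco, Finset.sum_eq_single_of_mem M hMmem]
    · simpa using (T_ne_zero_iff hp Fq hcard M hM.1.1).2 hM
    · intro m hm hne
      split_ifs with h
      · exact hz m hm h.ge hne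
      · rfl
  apply le_antisymm (natTrailingDegree_le_of_ne_zero hlead)
  apply le_natTrailingDegree
  · rintro h; rw [h] at hlead; simp at hlead
  · intro w hw
    rw [hco]
    apply Finset.sum_eq_zero
    intro m hm
    split_ifs with h
    · exact hz m hm (by omega) (by rintro rfl; omega)
    · rfl

end Sheats

/-- If `S_d(s) ≠ 0` (with `s = -k < 0`) and `M` is the modest element of
`U_d(k)` (its reverse is lexicographically largest), then `M` has strictly smaller weight
than every other element of `U_d(k)`, and the `t`-adic valuation of `S_d(s)` is `wtU M`. -/
theorem modest_min_weight_and_valuation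
    (p f : ℕ) (hp : p.Prime) (hf : 0 < f)
    (Fq : Type) [Field Fq] [Fintype Fq] (hcard : Fintype.card Fq = p ^ f)
    (d k : ℕ) (hk : 0 < k)
    (hS : powerSum Fq d k ≠ 0)
    (M : Fin (d + 1) → ℕ) (hM : M ∈ Uset p (p ^ f) d k)
    (hmax : ∀ m ∈ Uset p (p ^ f) d k, LexLE (m ∘ Fin.rev) (M ∘ Fin.rev)) :
    (∀ m ∈ Uset p (p ^ f) d k, m ≠ M → wtU M < wtU m) ∧
      (powerSum Fq d k).natTrailingDegree = wtU M := by
  have h1 := Sheats.part_one hp.two_le hf hM hmax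
  exact ⟨h1, Sheats.part_two hp Fq hcard hM h1⟩
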